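/- Let m be a multisegment and [a,b] a segment with a < b, and suppose ε_{[a]}(m) = 1. Then: (i) if D^Lang_{[a,b]}(m) ≠ ∞, then D^Lang_{[a+1,b]}(D_{[a]}(m)) = D^Lang_{[a,b]}(m); (ii) if ε_{[a+1]}(m) = 0 and D^Lang_{[a+1,b]}(D_{[a]}(m)) ≠ ∞, then D^Lang_{[a,b]}(m) = D^Lang_{[a+1,b]}(D_{[a]}(m)). -/

import Mathlib

namespace Multiseg

/-- A segment `[a,b]` on a fixed cuspidal line, encoded by its endpoints. -/
abbrev Seg := ℤ × ℤ

/-- A multiset of pairs is a multisegment when each pair is a genuine segment. -/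
def IsMS (m : Multiset Seg) : Prop := ∀ Δ ∈ m, Δ.1 ≤ Δ.2

/-- `Δ ≺ Δ'` : the segment `Δ` precedes `Δ'`. -/
def Prec (Δ Δ' : Seg) : Prop := Δ.1 < Δ'.1 ∧ Δ.2 < Δ'.2 ∧ Δ'.1 ≤ Δ.2 + 1

instance : DecidableRel Prec := fun _ _ => by unfold Prec; infer_instance

/-- `Δ ⊆ Δ'` as segments. -/
def SSub (Δ Δ' : Seg) : Prop := Δ'.1 ≤ Δ.1 ∧ Δ.2 ≤ Δ'.2

/-- `m[i]`, the segments of `m` starting at `i`. -/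
def startAt (m : Multiset Seg) (i : ℤ) : Multiset Seg := m.filter fun Δ => Δ.1 = i

/-- `m⟨i⟩`, the segments of `m` ending at `i`. -/
def endAt (m : Multiset Seg) (i : ℤ) : Multiset Seg := m.filter fun Δ => Δ.2 = i

/-- `m_{[a,b]} = {[a',b'] ∈ m : a ≤ a' ≤ b+1 ≤ b'+1}`. -/
def mRange (m : Multiset Seg) (a b : ℤ) : Multiset Seg :=
  m.filter fun Δ => a ≤ Δ.1 ∧ Δ.1 ≤ b + 1 ∧ b ≤ Δ.2

/-- Add the segment `[x,y]` to `m`, discarding it if it is void. -/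
def pushSeg (m : Multiset Seg) (x y : ℤ) : Multiset Seg :=
  if x ≤ y then m + {(x, y)} else m

def msetMax (s : Multiset ℤ) : Option ℤ :=
  if h : s = 0 then none else some (s.toFinset.max' (Multiset.toFinset_nonempty.mpr h))

def msetMin (s : Multiset ℤ) : Option ℤ :=
  if h : s = 0 then none else some (s.toFinset.min' (Multiset.toFinset_nonempty.mpr h))

/-- The longest segment of `m[i]`, if any. -/
def longStart (m : Multiset Seg) (i : ℤ) : Option Seg :=
  (msetMax ((startAt m i).map Prod.snd)).map fun y => (i, y)

/-- The shortest segment of `m[i]`, if any. -/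
def shortStart (m : Multiset Seg) (i : ℤ) : Option Seg :=
  (msetMin ((startAt m i).map Prod.snd)).map fun y => (i, y)

/-- The longest segment of `m⟨i⟩`, if any. -/
def longEnd (m : Multiset Seg) (i : ℤ) : Option Seg :=
  (msetMin ((endAt m i).map Prod.fst)).map fun x => (x, i)

/-- The shortest segment of `m⟨i⟩`, if any. -/
def shortEnd (m : Multiset Seg) (i : ℤ) : Option Seg :=
  (msetMax ((endAt m i).map Prod.fst)).map fun x => (x, i)

/-- One removal step of the `tds(·,c)` process: remove the longest segment `Δ''`
of `m[c+1]` and the longest segment `Δ'` of `m[c]` with `Δ' ≺ Δ''`. -/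
def tdsStep (m : Multiset Seg) (c : ℤ) : Option (Multiset Seg) :=
  match longStart m (c + 1) with
  | none => none
  | some Δ'' =>
    match msetMax (((startAt m c).filter fun Δ => Prec Δ Δ'').map Prod.snd) with
    | none => none
    | some y => some ((m.erase (c, y)).erase Δ'')

def tdsIterF (c : ℤ) : ℕ → Multiset Seg → Multiset Seg
  | 0, m => m
  | n + 1, m =>
    match tdsStep m c with
    | none => m
    | some m' => tdsIterF c n m'

/-- Iterate the `tds(·,c)` process until it terminates. -/
def tdsIter (c : ℤ) (m : Multiset Seg) : Multiset Seg := tdsIterF c m.card m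

/-- The `ρ`-derivative algorithm `𝒟_{[a]}`; the value `none` codes `∞`. -/
def Drho (a : ℤ) (m : Multiset Seg) : Option (Multiset Seg) :=
  (shortStart (tdsIter a m) a).map fun Δ => pushSeg (m.erase Δ) (a + 1) Δ.2

/-- `ε_{[a]}(m)`, the number of segments starting at `a` left after the
`tds(·,a)` process terminates. -/
def epsA (a : ℤ) (m : Multiset Seg) : ℕ := (startAt (tdsIter a m) a).card

/-- The next element of an upward sequence after `p`. -/
def usNext (n : Multiset Seg) (p : Seg) : Option Seg :=
  match msetMin ((n.filter fun Δ => Prec p Δ).map Prod.fst) with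
  | none => none
  | some aj =>
    (msetMax ((((n.filter fun Δ => Prec p Δ).filter fun Δ => Δ.1 = aj)).map Prod.snd)).map
      fun y => (aj, y)

def usAux (n : Multiset Seg) : ℕ → Seg → List Seg
  | 0, _ => []
  | fuel + 1, p =>
    match usNext n p with
    | none => []
    | some Δ => Δ :: usAux n fuel Δ

/-- The upward sequence `Us(n)` of maximally linked segments of `n`. -/
def usList (n : Multiset Seg) : List Seg :=
  match msetMin (n.map Prod.fst) with
  | none => []
  | some a1 =>
    match longStart n a1 with
    | none => []
    | some Δ1 => Δ1 :: usAux n n.card Δ1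

/-- The decomposition of a multisegment into successive upward sequences. -/
def usDecomp : ℕ → Multiset Seg → List (List Seg)
  | 0, _ => []
  | fuel + 1, n =>
    if n = 0 then [] else usList n :: usDecomp fuel (n - (usList n : Multiset Seg))

/-- `[x,y] ⊆ [u,v]` (with the void interval contained in anything). -/
def intSubB (x y u v : ℤ) : Bool := decide (y < x) || (decide (u ≤ x) && decide (y ≤ v))

/-- Find, in a row of an upward-sequence decomposition, the first segment `Δ`
whose removable free section contains `[s(Δ), top]`. -/
def findRowD : List Seg → ℤ → Option Seg
  | [], _ => none
  | [Δ], top => if intSubB Δ.1 top Δ.1 Δ.2 then some Δ else none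
  | Δ :: Δ' :: rest, top =>
    if intSubB Δ.1 top Δ.1 (Δ'.1 - 2) then some Δ else findRowD (Δ' :: rest) top

/-- The selection step of the Langlands derivative algorithm, scanning the rows
downwards from the last one; it records each selected segment together with the
start of its truncation. -/
def selAuxD (rows : List (List Seg)) : ℕ → ℤ → List (Seg × ℤ)
  | 0, _ => []
  | n + 1, top =>
    match findRowD (rows.getD n []) top with
    | some Δ => (Δ, top + 1) :: selAuxD rows n (Δ.1 - 1)
    | none => selAuxD rows n top

/-- The Langlands derivative algorithm `𝒟^Lang_{[a,b]}`; `none` codes `∞`. -/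
def DLang (a b : ℤ) (m : Multiset Seg) : Option (Multiset Seg) :=
  let m1 := mRange m a b
  let rows := usDecomp m1.card m1
  let sel := selAuxD rows rows.length b
  match sel.getLast? with
  | none => none
  | some (Δl, _) =>
    if Δl.1 = a then
      some (sel.foldl (fun acc p => pushSeg (acc.erase p.1) p.2 p.1.2) m)
    else none

/-- One removal step of the `tus(·,c)` process. -/
def tusStep (n : Multiset Seg) (c : ℤ) : Option (Multiset Seg) :=
  match shortStart n c with
  | none => none
  | some Δ' =>
    match msetMin (((startAt n (c + 1)).filter fun Δ => Prec Δ' Δ).map Prod.snd) with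
    | none => none
    | some y => some ((n.erase Δ').erase (c + 1, y))

def tusIterF (c : ℤ) : ℕ → Multiset Seg → Multiset Seg
  | 0, n => n
  | k + 1, n =>
    match tusStep n c with
    | none => n
    | some n' => tusIterF c k n'

/-- Iterate the `tus(·,c)` process until it terminates. -/
def tusIter (c : ℤ) (n : Multiset Seg) : Multiset Seg := tusIterF c n.card n

/-- The `ρ`-integral algorithm `ℐ_{[a]}` (always defined). -/
def Irho (a : ℤ) (n : Multiset Seg) : Multiset Seg :=
  match longStart (tusIter a n) (a + 1) with
  | none => n + {(a, a)}
  | some Δ => pushSeg (n.erase Δ) a Δ.2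

/-- The next element of a downward sequence after `p`. -/
def dsNext (n : Multiset Seg) (p : Seg) : Option Seg :=
  match msetMax ((n.filter fun Δ => Prec Δ p).map Prod.fst) with
  | none => none
  | some aq => shortStart n aq

def dsAux (n : Multiset Seg) : ℕ → Seg → List Seg
  | 0, _ => []
  | k + 1, p =>
    match dsNext n p with
    | none => []
    | some Δ => Δ :: dsAux n k Δ

/-- The downward sequence `Ds(n)` of minimal linked segments with the largest
starting. -/
def dsList (n : Multiset Seg) : List Seg :=
  match msetMax (n.map Prod.fst) with
  | none => []
  | some a1 =>
    match shortStart n a1 with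
    | none => []
    | some Δ1 => Δ1 :: dsAux n n.card Δ1

/-- The decomposition of a multisegment into successive downward sequences. -/
def dsDecomp : ℕ → Multiset Seg → List (List Seg)
  | 0, _ => []
  | k + 1, n =>
    if n = 0 then [] else dsList n :: dsDecomp k (n - (dsList n : Multiset Seg))

/-- Find, in a row of a downward-sequence decomposition, the segment whose set
of addable free points contains `pt`. -/
def findRowI (a : ℤ) : List Seg → ℤ → Option Seg
  | [], _ => none
  | [Δ], pt => if decide (a ≤ pt) && decide (pt ≤ Δ.1 - 1) then some Δ else none
  | Δ :: Δ' :: rest, pt =>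
    if decide (Δ'.1 + 1 ≤ pt) && decide (pt ≤ Δ.1 - 1) then some Δ
    else findRowI a (Δ' :: rest) pt

/-- The selection step of the Langlands integral algorithm; it records each
selected segment together with the start of its extension. -/
def selAuxI (a : ℤ) (rows : List (List Seg)) : ℕ → ℤ → List (Seg × ℤ)
  | 0, _ => []
  | n + 1, pt =>
    match findRowI a (rows.getD n []) pt with
    | some Δ => (Δ, pt) :: selAuxI a rows n Δ.1
    | none => selAuxI a rows n pt

/-- The Langlands integral algorithm `ℐ^Lang_{[a,b]}`. -/
def ILang (a b : ℤ) (m : Multiset Seg) : Multiset Seg :=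
  let m1 := mRange m a b
  let rows := dsDecomp m1.card m1
  let sel := selAuxI a rows rows.length a
  let base := sel.foldl (fun acc p => pushSeg (acc.erase p.1) p.2 p.1.2) m
  match sel.getLast? with
  | none => pushSeg base a b
  | some (Δl, _) => pushSeg base Δl.1 b

/-- `m` is in good range for `[a,b]`. -/
def GoodRange (m : Multiset Seg) (a b : ℤ) : Prop := mRange m a b = m

/-- `Θ`, the Gelfand–Kazhdan involution on multisegments. -/
def Theta (m : Multiset Seg) : Multiset Seg := m.map fun Δ => (-Δ.2, -Δ.1)

/-- The exotic duality `𝔻_r`. -/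
def Dual (r : ℤ) (m : Multiset Seg) : Multiset Seg :=
  m.map fun Δ => (-r + Δ.2 + 1, Δ.1 - 1)

/-- `𝔻_r^{[a,b]}`. -/
def DualAB (r a b : ℤ) (m : Multiset Seg) : Multiset Seg := Dual r m + {(b - r + 1, b)}

/-- The left Langlands derivative algorithm `𝒟^{Lang,L}_{[a,b]}`. -/
def DLangL (a b : ℤ) (m : Multiset Seg) : Option (Multiset Seg) :=
  (DLang (-b) (-a) (Theta m)).map Theta

/-- The left `ρ`-derivative algorithm `𝒟^{Lang,L}_{[a]}`. -/
def DrhoL (a : ℤ) (m : Multiset Seg) : Option (Multiset Seg) :=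
  (Drho (-a) (Theta m)).map Theta

/-- The next segment chosen by the MW algorithm after `p`. -/
def mwNext (m : Multiset Seg) (p : Seg) : Option Seg :=
  (msetMax (((endAt m (p.2 - 1)).filter fun Δ => Prec Δ p).map Prod.fst)).map
    fun x => (x, p.2 - 1)

def mwAux (m : Multiset Seg) : ℕ → Seg → List Seg
  | 0, _ => []
  | k + 1, p =>
    match mwNext m p with
    | none => []
    | some Δ => Δ :: mwAux m k Δ

/-- The ordered segments participating in the MW algorithm for `m`. -/
def mwList (m : Multiset Seg) : List Seg :=
  match msetMax (m.map Prod.snd) with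
  | none => []
  | some b0 =>
    match shortEnd m b0 with
    | none => []
    | some Δ0 => Δ0 :: mwAux m m.card Δ0

/-- `𝒟^MW(m)`. -/
def DMW (m : Multiset Seg) : Multiset Seg :=
  (mwList m).foldl (fun acc Δ => pushSeg (acc.erase Δ) Δ.1 (Δ.2 - 1)) m

/-- The first segment `Δ(m)` produced by the MW algorithm for `m`. -/
def mwFirstSeg (m : Multiset Seg) : Option Seg :=
  match (mwList m).head?, (mwList m).getLast? with
  | some Δ0, some Δk => some (Δk.1, Δ0.2)
  | _, _ => none

/-- The total relative length of a multisegment. -/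
def totalLen (m : Multiset Seg) : ℕ := (m.map fun Δ => (Δ.2 - Δ.1 + 1).toNat).sum

def sharpAux : ℕ → Multiset Seg → Multiset Seg
  | 0, _ => 0
  | k + 1, m =>
    if m = 0 then 0
    else
      match mwFirstSeg m with
      | none => 0
      | some Δ => Δ ::ₘ sharpAux k (DMW m)

/-- The Mœglin–Waldspurger involution `m^#`. -/
def msharp (m : Multiset Seg) : Multiset Seg := sharpAux (totalLen m) m

/-- `ε^MW_{[a,c]}(m)`, the multiplicity of `[a,c]` in `m^#`. -/
def epsMW (a c : ℤ) (m : Multiset Seg) : ℕ := (msharp m).count (a, c)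

/-- `m_i`: remove from `m` the participants of the first `i` runs of the MW
algorithm. -/
def mwStage (m : Multiset Seg) : ℕ → Multiset Seg
  | 0 => m
  | i + 1 => mwStage m i - (mwList (DMW^[i] m) : Multiset Seg)

/-- `MW_k(m)`: all segments ending at `k` participating in the first `r` runs
of the MW algorithm. -/
def MWkSet (m : Multiset Seg) (r : ℕ) (k : ℤ) : Multiset Seg :=
  ∑ i ∈ Finset.range r, (mwList (DMW^[i] m) : Multiset Seg).filter fun Δ => Δ.2 = k

def upNbrAux (m : Multiset Seg) : ℕ → Seg → Option (List Seg)
  | 0, p => some [p]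
  | k + 1, p =>
    match msetMin (((endAt m (p.2 + 1)).filter fun Δ => Prec p Δ).map Prod.fst) with
    | none => none
    | some x => (upNbrAux m k (x, p.2 + 1)).map fun l => p :: l

/-- The removal upward sequence of maximal linked segments in neighbors on `m`
ranging from `a-1` to `b` (if it exists). -/
def upSeqNbr (m : Multiset Seg) (a b : ℤ) : Option (List Seg) :=
  match longEnd m (a - 1) with
  | none => none
  | some Δ => upNbrAux m (b - (a - 1)).toNat Δ

def zelRemF (a b : ℤ) : ℕ → Multiset Seg → Multiset Seg
  | 0, m => m
  | k + 1, m =>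
    match upSeqNbr m a b with
    | none => m
    | some l => zelRemF a b k (m - (l : Multiset Seg))

/-- Repeatedly remove removal upward sequences of maximal linked segments in
neighbors ranging from `a-1` to `b`, until none exists. -/
def zelRem (a b : ℤ) (m : Multiset Seg) : Multiset Seg := zelRemF a b m.card m

def zelRemCountF (a b : ℤ) : ℕ → Multiset Seg → ℕ
  | 0, _ => 0
  | k + 1, m =>
    match upSeqNbr m a b with
    | none => 0
    | some l => zelRemCountF a b k (m - (l : Multiset Seg)) + 1

/-- The number of removal upward sequences of maximal linked segments in
neighbors ranging from `a-1` to `b` successively removed from `m`. -/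
def zelRemCount (a b : ℤ) (m : Multiset Seg) : ℕ := zelRemCountF a b m.card m

def downNbrAux (m : Multiset Seg) : ℕ → Seg → Option (List Seg)
  | 0, p => some [p]
  | k + 1, p =>
    match msetMax (((endAt m (p.2 - 1)).filter fun Δ => Prec Δ p).map Prod.fst) with
    | none => none
    | some x => (downNbrAux m k (x, p.2 - 1)).map fun l => p :: l

/-- The Zelevinsky derivative algorithm `𝒟^Zel_{[a,b]}`; `none` codes `∞`. -/
def DZel (a b : ℤ) (m : Multiset Seg) : Option (Multiset Seg) :=
  match shortEnd (zelRem a b m) b with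
  | none => none
  | some Δb =>
    match downNbrAux (zelRem a b m) (b - a).toNat Δb with
    | none => none
    | some l => some (l.foldl (fun acc Δ => pushSeg (acc.erase Δ) Δ.1 (Δ.2 - 1)) m)

/-- The downward sequence of minimal linked segments in neighbors on `m`
ranging from `b` to `a-1` (if it exists). -/
def downSeqNbr (m : Multiset Seg) (a b : ℤ) : Option (List Seg) :=
  match shortEnd m b with
  | none => none
  | some Δ => downNbrAux m (b - (a - 1)).toNat Δ

def izRemF (a b : ℤ) : ℕ → Multiset Seg → Multiset Seg
  | 0, m => m
  | k + 1, m =>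
    match downSeqNbr m a b with
    | none => m
    | some l => izRemF a b k (m - (l : Multiset Seg))

/-- Repeatedly remove downward sequences of minimal linked segments in
neighbors ranging from `b` to `a-1`, until none exists. -/
def izRem (a b : ℤ) (m : Multiset Seg) : Multiset Seg := izRemF a b m.card m

def extNext (m : Multiset Seg) (p : Seg) : Option Seg :=
  (msetMin (((endAt m (p.2 + 1)).filter fun Δ => Prec p Δ).map Prod.fst)).map
    fun x => (x, p.2 + 1)

def extAux (m : Multiset Seg) : ℕ → Option Seg → List (Option Seg)
  | 0, _ => []
  | k + 1, p =>
    let cur := p.bind (extNext m)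
    cur :: extAux m k cur

/-- The (possibly void) segments `Δ̃_{a-1}, …, Δ̃_{b-1}` participating in the
extension process of the Zelevinsky integral algorithm on `m`. -/
def extList (m : Multiset Seg) (a b : ℤ) : List (Option Seg) :=
  longEnd m (a - 1) :: extAux m (b - a).toNat (longEnd m (a - 1))

def applyExt : Multiset Seg → ℤ → List (Option Seg) → Multiset Seg
  | acc, _, [] => acc
  | acc, i, some Δ :: rest => applyExt (pushSeg (acc.erase Δ) Δ.1 (Δ.2 + 1)) (i + 1) rest
  | acc, i, none :: rest => applyExt (acc + {(i + 1, i + 1)}) (i + 1) rest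

/-- The Zelevinsky integral algorithm `ℐ^Zel_{[a,b]}`. -/
def IZel (a b : ℤ) (m : Multiset Seg) : Multiset Seg :=
  applyExt m (a - 1) (extList (izRem a b m) a b)

/-- `Δ̃⁺` for a possibly void `Δ̃` at position `i` (for the void segment at
position `i` this is the singleton `[i+1,i+1]`). -/
def plusAt (i : ℤ) : Option Seg → Seg
  | some Δ => (Δ.1, Δ.2 + 1)
  | none => (i + 1, i + 1)

def plusList : ℤ → List (Option Seg) → List Seg
  | _, [] => []
  | i, o :: rest => plusAt i o :: plusList (i + 1) rest

/-- `n₁` and `n₂` are linked by mapping: there is an injective map `f : n₁ → n₂`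
with `Δ ≺ f(Δ)` for all `Δ ∈ n₁`. -/
def LinkedByMapping (n₁ n₂ : Multiset Seg) : Prop :=
  ∃ n₂' ≤ n₂, Multiset.Rel Prec n₁ n₂'

def startsSorted (n : Multiset Seg) : List ℤ := (n.map Prod.fst).sort (· ≤ ·)

/-- `n₁' < n₁` for multisegments of segments ending at a common point, compared
via their sorted lists of starting points. -/
def MSLtStarts (n₁' n₁ : Multiset Seg) : Prop :=
  startsSorted n₁' ≠ startsSorted n₁ ∧
    List.Forall₂ (· ≤ ·) (startsSorted n₁) (startsSorted n₁')

/-- `n₁ ⊆ m⟨k-1⟩` and `n₂ ⊆ m⟨k⟩` are minimally linked in `m`. -/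
def MinLinked (m : Multiset Seg) (k : ℤ) (n₁ n₂ : Multiset Seg) : Prop :=
  n₁ ≤ endAt m (k - 1) ∧ n₂ ≤ endAt m k ∧ LinkedByMapping n₁ n₂ ∧
    (∀ n₁' ≤ endAt m (k - 1), LinkedByMapping n₁' n₂ → n₁'.card ≤ n₁.card) ∧
    (∀ n₁' ≤ endAt m (k - 1), n₁'.card = n₁.card → MSLtStarts n₁' n₁ →
      ¬LinkedByMapping n₁' n₂)

/-- The non-free sections of a row of an upward-sequence decomposition. -/
def nfRow : List Seg → Multiset Seg
  | [] => 0
  | [_] => 0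
  | Δ :: Δ' :: rest => pushSeg (nfRow (Δ' :: rest)) (Δ'.1 - 1) Δ.2

/-- `𝔡(m)`, the sum of all non-free sections. -/
def frakd (m : Multiset Seg) : Multiset Seg :=
  (usDecomp m.card m).foldl (fun acc row => acc + nfRow row) 0

def DrhoPow (t : ℤ) : ℕ → Multiset Seg → Option (Multiset Seg)
  | 0, m => some m
  | k + 1, m => (Drho t m).bind (DrhoPow t k)

/-- `(𝒟_{[a+n-1]})^{ε_{a+n-1}} ∘ ⋯ ∘ (𝒟_{[a]})^{ε_a}(m)` where at each stage `t`
the exponent is `ε_t = ε_{[t]}` of the current multisegment; `none` codes that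
some derivative in the composition is `∞`. -/
def hdComp : ℕ → ℤ → Multiset Seg → Option (Multiset Seg)
  | 0, _, m => some m
  | k + 1, t, m =>
    match DrhoPow t (epsA t m) m with
    | none => none
    | some m' => hdComp k (t + 1) m'


/-! ### Helper lemmas: extrema -/

theorem msetMax_eq_none {s : Multiset ℤ} : msetMax s = none ↔ s = 0 := by
  unfold msetMax; split_ifs <;> simp_all

theorem msetMin_eq_none {s : Multiset ℤ} : msetMin s = none ↔ s = 0 := by
  unfold msetMin; split_ifs <;> simp_all

theorem msetMax_eq_some {s : Multiset ℤ} {x : ℤ} :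
    msetMax s = some x ↔ x ∈ s ∧ ∀ y ∈ s, y ≤ x := by
  unfold msetMax
  split_ifs with h
  · subst h; simp
  · constructor
    · intro hx
      simp only [Option.some.injEq] at hx
      subst hx
      exact ⟨by simpa using Finset.max'_mem s.toFinset _,
        fun y hy => Finset.le_max' _ _ (by simpa using hy)⟩
    · rintro ⟨h1, h2⟩
      simp only [Option.some.injEq]
      apply le_antisymm
      · exact Finset.max'_le _ _ _ (fun y hy => h2 y (by simpa using hy))
      · exact Finset.le_max' _ _ (by simpa using h1)

theorem msetMin_eq_some {s : Multiset ℤ} {x : ℤ} :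
    msetMin s = some x ↔ x ∈ s ∧ ∀ y ∈ s, x ≤ y := by
  unfold msetMin
  split_ifs with h
  · subst h; simp
  · constructor
    · intro hx
      simp only [Option.some.injEq] at hx
      subst hx
      exact ⟨by simpa using Finset.min'_mem s.toFinset _,
        fun y hy => Finset.min'_le _ _ (by simpa using hy)⟩
    · rintro ⟨h1, h2⟩
      simp only [Option.some.injEq]
      apply le_antisymm
      · exact Finset.min'_le _ _ (by simpa using h1)
      · exact Finset.le_min' _ _ _ (fun y hy => h2 y (by simpa using hy))

theorem longStart_eq_none {m : Multiset Seg} {c : ℤ} :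
    longStart m c = none ↔ ∀ y, (c, y) ∉ m := by
  unfold longStart startAt
  rw [Option.map_eq_none_iff, msetMax_eq_none, Multiset.map_eq_zero,
    Multiset.filter_eq_nil]
  constructor
  · intro h y hy; exact h _ hy rfl
  · rintro h ⟨x, y⟩ hxy rfl; exact h y hxy

theorem longStart_eq_some {m : Multiset Seg} {c : ℤ} {Δ : Seg} :
    longStart m c = some Δ ↔ Δ ∈ m ∧ Δ.1 = c ∧ ∀ y, (c, y) ∈ m → y ≤ Δ.2 := by
  unfold longStart startAt
  simp only [Option.map_eq_some_iff, msetMax_eq_some, Multiset.mem_map, Multiset.mem_filter]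
  constructor
  · rintro ⟨y, ⟨⟨⟨x, z⟩, ⟨h1, h2⟩, h3⟩, h4⟩, rfl⟩
    simp only at h2 h3
    subst h2 h3
    exact ⟨h1, rfl, fun y hy => h4 y ⟨(x, y), ⟨hy, rfl⟩, rfl⟩⟩
  · rintro ⟨h1, rfl, h2⟩
    refine ⟨Δ.2, ⟨⟨Δ, ⟨h1, rfl⟩, rfl⟩, ?_⟩, rfl⟩
    rintro y ⟨⟨x, z⟩, ⟨h3, h4⟩, rfl⟩
    simp only at h4
    subst h4
    exact h2 _ h3

theorem usNext_eq_none {n : Multiset Seg} {p : Seg} :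
    usNext n p = none ↔ ∀ q ∈ n, ¬ Prec p q := by
  unfold usNext
  split
  · rename_i h
    rw [msetMin_eq_none, Multiset.map_eq_zero, Multiset.filter_eq_nil] at h
    simpa using h
  · rename_i x h
    rw [msetMin_eq_some] at h
    obtain ⟨h1, h2⟩ := h
    simp only [Multiset.mem_map, Multiset.mem_filter] at h1
    obtain ⟨q, ⟨hq1, hq2⟩, hq3⟩ := h1
    constructor
    · intro hh
      rw [Option.map_eq_none_iff, msetMax_eq_none, Multiset.map_eq_zero,
        Multiset.filter_eq_nil] at hh
      exact absurd hq3 (hh q (by simp [hq1, hq2]))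
    · intro hh; exact absurd hq2 (hh q hq1)

theorem usNext_eq_some {n : Multiset Seg} {p q : Seg} :
    usNext n p = some q ↔ q ∈ n ∧ Prec p q ∧
      ∀ r ∈ n, Prec p r → q.1 ≤ r.1 ∧ (r.1 = q.1 → r.2 ≤ q.2) := by
  unfold usNext
  split
  · rename_i h
    rw [msetMin_eq_none, Multiset.map_eq_zero, Multiset.filter_eq_nil] at h
    constructor
    · simp
    · rintro ⟨h1, h2, -⟩; exact absurd h2 (h q h1)
  · rename_i x h
    rw [msetMin_eq_some] at h
    obtain ⟨h1, h2⟩ := h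
    simp only [Multiset.mem_map, Multiset.mem_filter] at h1 h2
    obtain ⟨q0, ⟨hq1, hq2⟩, hq3⟩ := h1
    simp only [Option.map_eq_some_iff, msetMax_eq_some, Multiset.mem_map, Multiset.mem_filter]
    constructor
    · rintro ⟨y, ⟨⟨⟨u, v⟩, ⟨⟨h3, h4⟩, h5⟩, h6⟩, h7⟩, rfl⟩
      simp only at h5 h6
      subst h5 h6
      refine ⟨h3, h4, fun r hr hp => ⟨h2 _ ⟨r, ⟨hr, hp⟩, rfl⟩, fun he => ?_⟩⟩
      exact h7 _ ⟨r, ⟨⟨hr, hp⟩, he⟩, rfl⟩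
    · rintro ⟨h3, h4, h5⟩
      have hx : x = q.1 := by
        apply le_antisymm
        · exact h2 _ ⟨q, ⟨h3, h4⟩, rfl⟩
        · rw [← hq3]; exact (h5 q0 hq1 hq2).1
      subst hx
      refine ⟨q.2, ⟨⟨q, ⟨⟨h3, h4⟩, rfl⟩, rfl⟩, ?_⟩, rfl⟩
      rintro y ⟨r, ⟨⟨h6, h7⟩, h8⟩, rfl⟩
      exact (h5 r h6 h7).2 h8

/-! ### The tds process -/

theorem tdsStep_eq_some {m : Multiset Seg} {c : ℤ} {m' : Multiset Seg} :
    tdsStep m c = some m' ↔ ∃ e f, (c, e) ∈ m ∧ (c + 1, f) ∈ m ∧ (∀ y, (c + 1, y) ∈ m → y ≤ f) ∧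
      Prec (c, e) (c + 1, f) ∧ (∀ y, (c, y) ∈ m → Prec (c, y) (c + 1, f) → y ≤ e) ∧
      m' = (m.erase (c, e)).erase (c + 1, f) := by
  unfold tdsStep
  split
  · rename_i h
    rw [longStart_eq_none] at h
    constructor
    · simp
    · rintro ⟨e, f, -, h2, -⟩; exact absurd h2 (h f)
  · rename_i Δ h
    rw [longStart_eq_some] at h
    obtain ⟨h1, h2, h3⟩ := h
    obtain ⟨u, f⟩ := Δ
    simp only at h2 h3
    subst h2
    split
    · rename_i h
      rw [msetMax_eq_none, Multiset.map_eq_zero, Multiset.filter_eq_nil] at h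
      constructor
      · simp
      · rintro ⟨e, f', h4, h5, h6, h7, -⟩
        have : f' = f := le_antisymm (h3 _ h5) (h6 _ h1)
        subst this
        exact absurd h7 (h _ (by simp [startAt, h4]))
    · rename_i y h
      rw [msetMax_eq_some] at h
      simp only [Multiset.mem_map, Multiset.mem_filter, startAt] at h
      obtain ⟨⟨⟨u, v⟩, ⟨⟨h4, h5⟩, h6⟩, h7⟩, h8⟩ := h
      simp only at h5 h7
      subst h5 h7
      have h9 : ∀ y, (u, y) ∈ m → Prec (u, y) (u + 1, f) → y ≤ v :=
        fun y hy hp => h8 y ⟨(u, y), ⟨⟨hy, rfl⟩, hp⟩, rfl⟩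
      constructor
      · intro h
        simp only [Option.some.injEq] at h
        exact ⟨v, f, h4, h1, h3, h6, h9, h.symm⟩
      · rintro ⟨e', f', g1, g2, g3, g4, g5, rfl⟩
        have : f' = f := le_antisymm (h3 _ g2) (g3 _ h1)
        subst this
        have : e' = v := le_antisymm (h9 _ g1 g4) (g5 _ h4 h6)
        subst this
        rfl

theorem tdsStep_eq_none {m : Multiset Seg} {c : ℤ} :
    tdsStep m c = none ↔ ∀ f, (c + 1, f) ∈ m → (∀ y, (c + 1, y) ∈ m → y ≤ f) →
      ∀ e, (c, e) ∈ m → ¬ Prec (c, e) (c + 1, f) := by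
  unfold tdsStep
  split
  · rename_i h
    rw [longStart_eq_none] at h
    simp only [true_iff]
    intro f hf; exact absurd hf (h f)
  · rename_i Δ h
    rw [longStart_eq_some] at h
    obtain ⟨h1, h2, h3⟩ := h
    obtain ⟨u, f⟩ := Δ
    simp only at h2 h3
    subst h2
    split
    · rename_i h
      rw [msetMax_eq_none, Multiset.map_eq_zero, Multiset.filter_eq_nil] at h
      simp only [true_iff]
      intro f' h5 h6 e h4
      have : f' = f := le_antisymm (h3 _ h5) (h6 _ h1)
      subst this
      exact h _ (by simp [startAt, h4])
    · rename_i y h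
      rw [msetMax_eq_some] at h
      simp only [Multiset.mem_map, Multiset.mem_filter, startAt] at h
      obtain ⟨⟨⟨u, v⟩, ⟨⟨h4, h5⟩, h6⟩, h7⟩, h8⟩ := h
      simp only at h5 h7
      subst h5 h7
      simp only [reduceCtorEq, false_iff]
      intro hh
      exact hh f h1 h3 v h4 h6

theorem tdsStep_card {m m' : Multiset Seg} {c : ℤ} (h : tdsStep m c = some m') :
    m'.card + 2 = m.card := by
  rw [tdsStep_eq_some] at h
  obtain ⟨e, f, h1, h2, -, -, -, rfl⟩ := h
  have h3 : (c + 1, f) ∈ m.erase (c, e) := by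
    rw [Multiset.mem_erase_of_ne]; · exact h2
    · simp
  have := Multiset.card_erase_add_one h1
  have := Multiset.card_erase_add_one h3
  omega

theorem tdsIterF_fuel (c : ℤ) : ∀ (k k' : ℕ) (m : Multiset Seg), m.card ≤ k → m.card ≤ k' →
    tdsIterF c k m = tdsIterF c k' m := by
  intro k
  induction k with
  | zero =>
    intro k' m h h'
    cases k' with
    | zero => rfl
    | succ k' =>
      simp only [tdsIterF]
      split
      · rfl
      · rename_i h2; have := tdsStep_card h2; omega
  | succ k ih =>
    intro k' m h h'
    cases k' with
    | zero =>
      simp only [tdsIterF]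
      split
      · rfl
      · rename_i h2; have := tdsStep_card h2; omega
    | succ k' =>
      simp only [tdsIterF]
      split
      · rfl
      · rename_i h2; have := tdsStep_card h2; exact ih _ _ (by omega) (by omega)

theorem tdsIter_of_none {c : ℤ} {m : Multiset Seg} (h : tdsStep m c = none) :
    tdsIter c m = m := by
  unfold tdsIter
  cases hk : m.card with
  | zero => rfl
  | succ k => simp [tdsIterF, h]

theorem tdsIter_of_some {c : ℤ} {m m' : Multiset Seg} (h : tdsStep m c = some m') :
    tdsIter c m = tdsIter c m' := by
  unfold tdsIter
  have := tdsStep_card h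
  cases hk : m.card with
  | zero => omega
  | succ k => simp only [tdsIterF, h]; exact tdsIterF_fuel c _ _ _ (by omega) le_rfl

/-- Unmatched segments at `c`. -/
def unm (c : ℤ) (m : Multiset Seg) : Multiset Seg := startAt (tdsIter c m) c

theorem tdsStep_le {m m' : Multiset Seg} {c : ℤ} (h : tdsStep m c = some m') : m' ≤ m := by
  rw [tdsStep_eq_some] at h
  obtain ⟨e, f, h1, h2, -, -, -, rfl⟩ := h
  exact (Multiset.erase_le _ _).trans (Multiset.erase_le _ _)

theorem tdsIter_le (c : ℤ) (m : Multiset Seg) : tdsIter c m ≤ m := by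
  induction hk : m.card using Nat.strong_induction_on generalizing m with
  | _ k ih =>
    cases h : tdsStep m c with
    | none => rw [tdsIter_of_none h]
    | some m' =>
      rw [tdsIter_of_some h]
      have := tdsStep_card h
      exact (ih m'.card (by omega) m' rfl).trans (tdsStep_le h)

theorem unm_le (c : ℤ) (m : Multiset Seg) : unm c m ≤ m :=
  (Multiset.filter_le _ _).trans (tdsIter_le c m)

theorem unm_of_none {c : ℤ} {m : Multiset Seg} (h : tdsStep m c = none) :
    unm c m = startAt m c := by
  unfold unm; rw [tdsIter_of_none h]

theorem unm_of_some {c : ℤ} {m m' : Multiset Seg} (h : tdsStep m c = some m') :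
    unm c m = unm c m' := by
  unfold unm; rw [tdsIter_of_some h]

theorem unm_matched {c e f : ℤ} {m : Multiset Seg} (h1 : (c, e) ∈ m)
    (h2 : ∀ y, (c, y) ∈ m → y ≤ e) (h3 : (c + 1, f) ∈ m) (h4 : ∀ y, (c + 1, y) ∈ m → y ≤ f)
    (h5 : Prec (c, e) (c + 1, f)) :
    unm c m = unm c ((m.erase (c, e)).erase (c + 1, f)) := by
  apply unm_of_some
  rw [tdsStep_eq_some]
  exact ⟨e, f, h1, h3, h4, h5, fun y hy _ => h2 y hy, rfl⟩

theorem unm_free {c e : ℤ} (m : Multiset Seg) (h1 : (c, e) ∈ m)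
    (h2 : ∀ y, (c + 1, y) ∈ m → y ≤ e) :
    unm c m = (c, e) ::ₘ unm c (m.erase (c, e)) := by
  induction hk : m.card using Nat.strong_induction_on generalizing m with
  | _ k ih =>
    cases h : tdsStep m c with
    | none =>
      rw [unm_of_none h]
      have h' : tdsStep (m.erase (c, e)) c = none := by
        rw [tdsStep_eq_none] at h ⊢
        intro f hf hmax e' he'
        refine h f (Multiset.mem_of_mem_erase hf) (fun y hy => hmax y ?_) e'
          (Multiset.mem_of_mem_erase he')
        rw [Multiset.mem_erase_of_ne (by simp)]; exact hy
      rw [unm_of_none h']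
      unfold startAt
      conv_lhs => rw [← Multiset.cons_erase h1]
      rw [Multiset.filter_cons_of_pos (p := fun Δ : Seg => Δ.1 = c) _ rfl]
    | some m' =>
      have hc := tdsStep_card h
      rw [unm_of_some h]
      have hs := h
      rw [tdsStep_eq_some] at hs
      obtain ⟨e1, f1, g1, g2, g3, g4, g5, g6⟩ := hs
      have hne : (c, e) ≠ (c, e1) := by
        intro hh
        simp only [Prod.mk.injEq, true_and] at hh
        have := g4.2.1
        have := h2 _ g2
        simp only at *
        omega
      have hne2 : (c, e) ≠ (c + 1, f1) := by simp
      have hmem : (c, e) ∈ m' := by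
        rw [g6, Multiset.mem_erase_of_ne hne2, Multiset.mem_erase_of_ne hne]; exact h1
      have h' : tdsStep (m.erase (c, e)) c = some (m'.erase (c, e)) := by
        rw [tdsStep_eq_some]
        refine ⟨e1, f1, ?_, ?_, fun y hy => g3 y (Multiset.mem_of_mem_erase hy), g4,
          fun y hy => g5 y (Multiset.mem_of_mem_erase hy), ?_⟩
        · rw [Multiset.mem_erase_of_ne hne.symm]; exact g1
        · rw [Multiset.mem_erase_of_ne hne2.symm]; exact g2
        · rw [g6, Multiset.erase_comm _ (c + 1, f1), Multiset.erase_comm _ (c, e1)]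
      rw [unm_of_some h']
      exact ih m'.card (by omega) m' hmem
        (fun y hy => h2 y (Multiset.mem_of_le (tdsStep_le h) hy)) rfl

theorem filter_erase_comm (P : Seg → Prop) [DecidablePred P] (n : Multiset Seg) (Δ : Seg) :
    (n.erase Δ).filter P = (n.filter P).erase Δ := by
  by_cases hP : P Δ
  · rw [← Multiset.sub_singleton, Multiset.filter_sub, Multiset.filter_singleton, if_pos hP,
      Multiset.sub_singleton]
  · have h : Δ ∉ n.filter P := fun hh => hP (Multiset.mem_filter.mp hh).2
    rw [Multiset.erase_of_notMem h, ← Multiset.sub_singleton, Multiset.filter_sub,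
      Multiset.filter_singleton, if_neg hP]
    simp

theorem unm_filter {c b : ℤ} (Q : ℤ → Prop) [DecidablePred Q] (hQ : Q c) (hQ' : Q (c + 1))
    (m : Multiset Seg) :
    unm c (m.filter fun Δ => Q Δ.1 ∧ b ≤ Δ.2) = (unm c m).filter fun Δ => b ≤ Δ.2 := by
  induction hk : m.card using Nat.strong_induction_on generalizing m with
  | _ k ih =>
    have key : ∀ n : Multiset Seg, startAt (n.filter fun Δ => Q Δ.1 ∧ b ≤ Δ.2) c =
        (startAt n c).filter fun Δ => b ≤ Δ.2 := by
      intro n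
      unfold startAt
      rw [Multiset.filter_filter, Multiset.filter_filter]
      apply Multiset.filter_congr
      rintro ⟨x, y⟩ _
      simp only
      constructor
      · rintro ⟨rfl, -, h⟩; exact ⟨h, rfl⟩
      · rintro ⟨h, rfl⟩; exact ⟨rfl, hQ, h⟩
    have mem1 : ∀ y, (c, y) ∈ (m.filter fun Δ => Q Δ.1 ∧ b ≤ Δ.2) ↔ (c, y) ∈ m ∧ b ≤ y := by
      intro y; simp [hQ]
    have mem2 : ∀ y, (c + 1, y) ∈ (m.filter fun Δ => Q Δ.1 ∧ b ≤ Δ.2) ↔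
        (c + 1, y) ∈ m ∧ b ≤ y := by
      intro y; simp [hQ']
    have filt_erase : ∀ (n : Multiset Seg) (Δ : Seg), (n.erase Δ).filter (fun Δ => Q Δ.1 ∧ b ≤ Δ.2)
        = (n.filter (fun Δ => Q Δ.1 ∧ b ≤ Δ.2)).erase Δ := by
      intro n Δ; exact filter_erase_comm _ _ _
    cases h : tdsStep m c with
    | none =>
      rw [unm_of_none h]
      rw [unm_of_none, key]
      rw [tdsStep_eq_none] at h ⊢
      intro f hf hmax e he
      rw [mem2] at hf
      rw [mem1] at he
      refine h f hf.1 (fun y hy => ?_) e he.1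
      by_cases hb : b ≤ y
      · exact hmax y ((mem2 y).2 ⟨hy, hb⟩)
      · omega
    | some m' =>
      have hc := tdsStep_card h
      rw [unm_of_some h]
      rw [← ih m'.card (by omega) m' rfl]
      rw [tdsStep_eq_some] at h
      obtain ⟨e, f, g1, g2, g3, g4, g5, g6⟩ := h
      have hef : e < f := g4.2.1
      rw [g6, filt_erase, filt_erase]
      by_cases hf : b ≤ f
      · by_cases he : b ≤ e
        · apply unm_of_some
          rw [tdsStep_eq_some]
          exact ⟨e, f, (mem1 e).2 ⟨g1, he⟩, (mem2 f).2 ⟨g2, hf⟩,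
            fun y hy => g3 y ((mem2 y).1 hy).1, g4,
            fun y hy => g5 y ((mem1 y).1 hy).1, rfl⟩
        · have hnot : (c, e) ∉ (m.filter fun Δ => Q Δ.1 ∧ b ≤ Δ.2) := by
            rw [mem1]; tauto
          rw [Multiset.erase_of_notMem hnot]
          have hall : ∀ y z, (c, y) ∈ (m.filter fun Δ => Q Δ.1 ∧ b ≤ Δ.2) →
              (c + 1, z) ∈ (m.filter fun Δ => Q Δ.1 ∧ b ≤ Δ.2) →
              ¬ Prec (c, y) (c + 1, z) := by
            intro y z hy hz hp
            have hz' := g3 z ((mem2 z).1 hz).1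
            have hy' := (mem1 y).1 hy
            have : y ≤ e := by
              apply g5 y hy'.1
              obtain ⟨p1, p2, p3⟩ := hp
              exact ⟨p1, lt_of_lt_of_le p2 hz', p3⟩
            omega
          rw [unm_of_none, unm_of_none]
          · unfold startAt
            rw [← Multiset.sub_singleton, Multiset.filter_sub, Multiset.filter_singleton, if_neg]
            · simp
            · simp
          · rw [tdsStep_eq_none]
            intro z hz _ y hy
            exact hall y z (Multiset.mem_of_mem_erase hy) (Multiset.mem_of_mem_erase hz)
          · rw [tdsStep_eq_none]
            intro z hz _ y hy
            exact hall y z hy hz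
      · rw [Multiset.erase_of_notMem (a := (c, e)), Multiset.erase_of_notMem]
        · rw [mem2]; tauto
        · rw [mem1]; intro hh; omega

/-! ### Upward sequences -/

theorem usNext_congr {n n' : Multiset Seg} {p : Seg}
    (h : n.filter (fun q => p.1 < q.1) = n'.filter (fun q => p.1 < q.1)) :
    usNext n p = usNext n' p := by
  have h2 : n.filter (fun q => Prec p q) = n'.filter (fun q => Prec p q) := by
    have e : ∀ k : Multiset Seg, k.filter (fun q => Prec p q) =
        (k.filter (fun q => p.1 < q.1)).filter (fun q => Prec p q) := by
      intro k
      rw [Multiset.filter_filter]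
      apply Multiset.filter_congr
      intro q _
      exact ⟨fun hq => ⟨hq, hq.1⟩, fun hq => hq.1⟩
    rw [e n, e n', h]
  unfold usNext
  rw [h2]

theorem filter_lt_card {n : Multiset Seg} {p q : Seg} (hq : q ∈ n) (hpq : p.1 < q.1) :
    (n.filter (fun r => q.1 < r.1)).card < (n.filter (fun r => p.1 < r.1)).card := by
  apply Multiset.card_lt_card
  refine lt_of_le_of_ne (Multiset.monotone_filter_right _ (fun r hr => lt_trans hpq hr)) ?_
  intro he
  have h1 : q ∈ n.filter (fun r => p.1 < r.1) := by simp [hq, hpq]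
  rw [← he] at h1
  simp at h1

theorem filter_lt_trans {n n' : Multiset Seg} {x y : ℤ} (hxy : x ≤ y)
    (h : n.filter (fun q => x < q.1) = n'.filter (fun q => x < q.1)) :
    n.filter (fun q => y < q.1) = n'.filter (fun q => y < q.1) := by
  have e : ∀ k : Multiset Seg, k.filter (fun q => y < q.1) =
        (k.filter (fun q => x < q.1)).filter (fun q => y < q.1) := by
    intro k
    rw [Multiset.filter_filter]
    apply Multiset.filter_congr
    intro q _
    constructor
    · intro h; exact ⟨h, by omega⟩
    · intro h; exact h.1
  rw [e n, e n', h]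

theorem usAux_congr : ∀ (k k' : ℕ) (n n' : Multiset Seg) (p : Seg),
    n.filter (fun q => p.1 < q.1) = n'.filter (fun q => p.1 < q.1) →
    (n.filter (fun q => p.1 < q.1)).card ≤ k → (n.filter (fun q => p.1 < q.1)).card ≤ k' →
    usAux n k p = usAux n' k' p := by
  intro k
  induction k with
  | zero =>
    intro k' n n' p h hk hk'
    cases k' with
    | zero => rfl
    | succ k' =>
      simp only [usAux]
      split
      · rfl
      · rename_i q hq
        rw [← usNext_congr h, usNext_eq_some] at hq
        have := filter_lt_card hq.1 hq.2.1.1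
        omega
  | succ k ih =>
    intro k' n n' p h hk hk'
    cases k' with
    | zero =>
      simp only [usAux]
      split
      · rfl
      · rename_i q hq
        rw [usNext_eq_some] at hq
        have := filter_lt_card hq.1 hq.2.1.1
        omega
    | succ k' =>
      simp only [usAux]
      rw [← usNext_congr h]
      split
      · rfl
      · rename_i q hq
        rw [usNext_eq_some] at hq
        have := filter_lt_card hq.1 hq.2.1.1
        rw [ih k' n n' q (filter_lt_trans hq.2.1.1.le h) (by omega) (by omega)]

/-- The upward chain strictly above `p`. -/
def usChain (n : Multiset Seg) (p : Seg) : List Seg := usAux n n.card p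

theorem usChain_congr {n n' : Multiset Seg} {p : Seg}
    (h : n.filter (fun q => p.1 < q.1) = n'.filter (fun q => p.1 < q.1)) :
    usChain n p = usChain n' p := by
  unfold usChain
  apply usAux_congr _ _ _ _ _ h (Multiset.card_le_card (Multiset.filter_le _ _))
  rw [h]; exact Multiset.card_le_card (Multiset.filter_le _ _)

theorem usChain_none {n : Multiset Seg} {p : Seg} (h : usNext n p = none) : usChain n p = [] := by
  unfold usChain
  cases n.card with
  | zero => rfl
  | succ k => simp [usAux, h]

theorem usChain_some {n : Multiset Seg} {p q : Seg} (h : usNext n p = some q) :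
    usChain n p = q :: usChain n q := by
  have hq := usNext_eq_some.1 h
  unfold usChain
  have hc : (n.filter (fun r => p.1 < r.1)).card ≤ n.card :=
    Multiset.card_le_card (Multiset.filter_le _ _)
  have hl := filter_lt_card hq.1 hq.2.1.1
  cases hk : n.card with
  | zero => omega
  | succ k =>
    have h2 : usAux n (k + 1) p = q :: usAux n k q := by simp [usAux, h]
    rw [h2, usAux_congr k (k + 1) n n q rfl (by omega) (by omega)]

/-- Chain induction. -/
theorem usChain_induct {n : Multiset Seg} (C : Seg → Prop)
    (h0 : ∀ p, usNext n p = none → C p) (h1 : ∀ p q, usNext n p = some q → C q → C p) (p : Seg) :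
    C p := by
  induction hk : (n.filter (fun r => p.1 < r.1)).card using Nat.strong_induction_on
    generalizing p with
  | _ k ih =>
    cases h : usNext n p with
    | none => exact h0 p h
    | some q =>
      have hq := usNext_eq_some.1 h
      have hl := filter_lt_card hq.1 hq.2.1.1
      exact h1 p q h (ih _ (by omega) q rfl)

theorem usChain_mem {n : Multiset Seg} (p : Seg) : ∀ q ∈ usChain n p, q ∈ n ∧ p.1 < q.1 := by
  apply usChain_induct (n := n) (C := fun p => ∀ q ∈ usChain n p, q ∈ n ∧ p.1 < q.1)
  · intro p h; rw [usChain_none h]; simp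
  · intro p q h ih
    have hq := usNext_eq_some.1 h
    rw [usChain_some h]
    intro r hr
    rcases List.mem_cons.1 hr with rfl | hr
    · exact ⟨hq.1, hq.2.1.1⟩
    · have := ih r hr
      exact ⟨this.1, lt_trans hq.2.1.1 this.2⟩

theorem usChain_nodup {n : Multiset Seg} (p : Seg) : (p :: usChain n p).Nodup := by
  apply usChain_induct (n := n) (C := fun p => (p :: usChain n p).Nodup)
  · intro p h; rw [usChain_none h]; simp
  · intro p q h ih
    rw [List.nodup_cons]
    constructor
    · intro hp; exact lt_irrefl _ (usChain_mem p p hp).2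
    · rw [usChain_some h]; exact ih

/-- Description of the first row. -/
theorem usList_eq {n : Multiset Seg} {c e : ℤ} (h1 : (c, e) ∈ n) (h2 : ∀ Δ ∈ n, c ≤ Δ.1)
    (h3 : ∀ y, (c, y) ∈ n → y ≤ e) : usList n = (c, e) :: usChain n (c, e) := by
  have hm : msetMin (n.map Prod.fst) = some c := by
    rw [msetMin_eq_some]
    constructor
    · exact Multiset.mem_map.2 ⟨(c, e), h1, rfl⟩
    · intro y hy
      obtain ⟨Δ, hΔ, rfl⟩ := Multiset.mem_map.1 hy
      exact h2 Δ hΔ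
  have hl : longStart n c = some (c, e) := by
    rw [longStart_eq_some]; exact ⟨h1, rfl, h3⟩
  unfold usList
  rw [hm]
  simp only [hl]
  rfl

theorem exists_max_end {n : Multiset Seg} {c : ℤ} (h : ∃ y, (c, y) ∈ n) :
    ∃ e, (c, e) ∈ n ∧ ∀ y, (c, y) ∈ n → y ≤ e := by
  cases hl : longStart n c with
  | none =>
    rw [longStart_eq_none] at hl
    obtain ⟨y, hy⟩ := h; exact absurd hy (hl y)
  | some Δ =>
    obtain ⟨u, v⟩ := Δ
    rw [longStart_eq_some] at hl
    obtain ⟨g1, rfl, g2⟩ := hl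
    exact ⟨v, g1, g2⟩

theorem exists_first {n : Multiset Seg} (h : n ≠ 0) :
    ∃ c e, (c, e) ∈ n ∧ (∀ Δ ∈ n, c ≤ Δ.1) ∧ ∀ y, (c, y) ∈ n → y ≤ e := by
  cases hm : msetMin (n.map Prod.fst) with
  | none => rw [msetMin_eq_none, Multiset.map_eq_zero] at hm; exact absurd hm h
  | some c =>
    rw [msetMin_eq_some] at hm
    obtain ⟨h1, h2⟩ := hm
    obtain ⟨⟨u, v⟩, hΔ, rfl⟩ := Multiset.mem_map.1 h1
    obtain ⟨e, he, he'⟩ := exists_max_end ⟨v, hΔ⟩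
    exact ⟨u, e, he, fun Δ hΔ => h2 _ (Multiset.mem_map.2 ⟨Δ, hΔ, rfl⟩), he'⟩

theorem usList_le (n : Multiset Seg) : (usList n : Multiset Seg) ≤ n := by
  by_cases h : n = 0
  · subst h; simp [usList, msetMin]
  · obtain ⟨c, e, h1, h2, h3⟩ := exists_first h
    rw [usList_eq h1 h2 h3]
    rw [Multiset.le_iff_subset (by simpa using usChain_nodup (n := n) (c, e))]
    intro q hq
    rcases List.mem_cons.1 (Multiset.mem_coe.1 hq) with rfl | hq
    · exact h1
    · exact (usChain_mem _ q hq).1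

theorem usList_sub_card {n : Multiset Seg} (h : n ≠ 0) :
    (n - (usList n : Multiset Seg)).card < n.card := by
  have hle := usList_le n
  rw [Multiset.card_sub hle]
  have : 0 < (usList n : Multiset Seg).card := by
    obtain ⟨c, e, h1, h2, h3⟩ := exists_first h
    rw [usList_eq h1 h2 h3]; simp
  have := Multiset.card_le_card hle
  omega

theorem usDecomp_fuel : ∀ (k k' : ℕ) (n : Multiset Seg), n.card ≤ k → n.card ≤ k' →
    usDecomp k n = usDecomp k' n := by
  intro k
  induction k with
  | zero =>
    intro k' n h _
    have : n = 0 := by simpa using h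
    subst this
    cases k' <;> simp [usDecomp]
  | succ k ih =>
    intro k' n h h'
    by_cases h0 : n = 0
    · subst h0; cases k' <;> simp [usDecomp]
    · have := usList_sub_card h0
      cases k' with
      | zero => exact absurd (by simpa using h') h0
      | succ k' =>
        simp only [usDecomp, h0, if_false]
        rw [ih k' _ (by omega) (by omega)]

/-- The rows of the decomposition. -/
def rowsOf (n : Multiset Seg) : List (List Seg) := usDecomp n.card n

theorem rowsOf_zero : rowsOf 0 = [] := by simp [rowsOf, usDecomp]

theorem rowsOf_eq {n : Multiset Seg} (h : n ≠ 0) :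
    rowsOf n = usList n :: rowsOf (n - (usList n : Multiset Seg)) := by
  have := usList_sub_card h
  unfold rowsOf
  cases hk : n.card with
  | zero => exact absurd (by simpa using hk) h
  | succ k =>
    simp only [usDecomp, h, if_false]
    rw [usDecomp_fuel k _ _ (by omega) le_rfl]

theorem rowsOf_flatten_le (n : Multiset Seg) : ((rowsOf n).flatten : Multiset Seg) ≤ n := by
  induction hk : n.card using Nat.strong_induction_on generalizing n with
  | _ k ih =>
    by_cases h : n = 0
    · subst h; simp [rowsOf_zero]
    · rw [rowsOf_eq h, List.flatten_cons, ← Multiset.coe_add]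
      have := usList_sub_card h
      have h2 := ih _ (by omega) (n - (usList n : Multiset Seg)) rfl
      calc _ ≤ (usList n : Multiset Seg) + (n - (usList n : Multiset Seg)) := by gcongr
        _ = n := add_tsub_cancel_of_le (usList_le n)

theorem rowsOf_mem {n : Multiset Seg} {row : List Seg} (hr : row ∈ rowsOf n) {Δ : Seg}
    (hΔ : Δ ∈ row) : Δ ∈ n :=
  Multiset.mem_of_le (rowsOf_flatten_le n) (Multiset.mem_coe.2 (List.mem_flatten.2 ⟨row, hr, hΔ⟩))

/-! ### Comparing rows -/

/-- All segments lie in the good range. -/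
def Good (a b : ℤ) (n : Multiset Seg) : Prop :=
  ∀ Δ ∈ n, a ≤ Δ.1 ∧ Δ.1 ≤ b + 1 ∧ b ≤ Δ.2 ∧ Δ.1 ≤ Δ.2

theorem Good.mono {a b : ℤ} {n n' : Multiset Seg} (h : Good a b n) (hle : n' ≤ n) : Good a b n' :=
  fun Δ hΔ => h Δ (Multiset.mem_of_le hle hΔ)

theorem unm_local {a b c : ℤ} {n n' : Multiset Seg} (h : Good a b n) (h' : Good a b n')
    (hf : n.filter (fun Δ => Δ.1 = c ∨ Δ.1 = c + 1) = n'.filter (fun Δ => Δ.1 = c ∨ Δ.1 = c + 1)) :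
    unm c n = unm c n' := by
  have e1 : ∀ k : Multiset Seg, Good a b k → unm c k = unm c
      (k.filter (fun Δ => (Δ.1 = c ∨ Δ.1 = c + 1) ∧ b ≤ Δ.2)) := by
    intro k hk
    rw [unm_filter (fun x => x = c ∨ x = c + 1) (Or.inl rfl) (Or.inr rfl)]
    rw [Multiset.filter_eq_self.2]
    intro Δ hΔ
    exact (hk Δ (Multiset.mem_of_le (unm_le c k) hΔ)).2.2.1
  have e2 : ∀ k : Multiset Seg, Good a b k →
      k.filter (fun Δ => (Δ.1 = c ∨ Δ.1 = c + 1) ∧ b ≤ Δ.2) =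
      k.filter (fun Δ => Δ.1 = c ∨ Δ.1 = c + 1) := by
    intro k hk
    apply Multiset.filter_congr
    intro Δ hΔ
    exact ⟨fun h => h.1, fun h => ⟨h, (hk Δ hΔ).2.2.1⟩⟩
  rw [e1 n h, e1 n' h', e2 n h, e2 n' h', hf]

theorem unm_sub_other {a b c : ℤ} {n : Multiset Seg} (h : Good a b n) (l : Multiset Seg)
    (hl : ∀ x ∈ l, x.1 ≠ c ∧ x.1 ≠ c + 1) : unm c (n - l) = unm c n := by
  apply unm_local (h.mono tsub_le_self) h
  rw [Multiset.filter_sub]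
  rw [(Multiset.filter_eq_nil (s := l)).2 (fun x hx => by have := hl x hx; tauto)]
  simp

theorem prec_iff {a b : ℤ} {n : Multiset Seg} (h : Good a b n) {p q : Seg} (hp : b ≤ p.2)
    (hq : q ∈ n) : Prec p q ↔ p.1 < q.1 ∧ p.2 < q.2 := by
  have := h q hq
  unfold Prec
  constructor
  · rintro ⟨h1, h2, -⟩; exact ⟨h1, h2⟩
  · rintro ⟨h1, h2⟩; exact ⟨h1, h2, by omega⟩

/-- If a longer segment starts at `c + 1`, it is next after `(c, e)`. -/
theorem usNext_adj {a b c e f : ℤ} {n : Multiset Seg} (h : Good a b n) (he : b ≤ e)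
    (hf : (c + 1, f) ∈ n) (hmax : ∀ y, (c + 1, y) ∈ n → y ≤ f) (hef : e < f) :
    usNext n (c, e) = some (c + 1, f) := by
  rw [usNext_eq_some]
  refine ⟨hf, (prec_iff h he hf).2 ⟨by simp, hef⟩, ?_⟩
  intro r hr hp
  have h1 : c < r.1 := hp.1
  refine ⟨by simp only; omega, fun heq => ?_⟩
  apply hmax
  simp only at heq
  rw [← heq]; exact hr

/-- Remove the head of a row if it starts at `a`. -/
def dropHead (a : ℤ) : List Seg → List Seg
  | [] => []
  | Δ :: r => if Δ.1 = a then r else Δ :: r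

/-- A row whose head starts at `c` continues with a segment starting at `c + 1`. -/
def HeadPair (c : ℤ) (row : List Seg) : Prop :=
  ∀ Δ r, row = Δ :: r → Δ.1 = c → ∃ Δ' r', r = Δ' :: r' ∧ Δ'.1 = c + 1

theorem dropHead_of_ne {a : ℤ} {row : List Seg} (h : ∀ Δ ∈ row, Δ.1 ≠ a) :
    dropHead a row = row := by
  cases row with
  | nil => rfl
  | cons Δ r => simp [dropHead, h Δ (by simp)]

theorem sub_cons_cons (n : Multiset Seg) (x y : Seg) (l : List Seg) :
    n - ((x :: y :: l : List Seg) : Multiset Seg) = (n.erase x).erase y - (l : Multiset Seg) := by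
  rw [← Multiset.cons_coe, Multiset.sub_cons, ← Multiset.cons_coe, Multiset.sub_cons]

theorem filter_sub_row {a : ℤ} (n : Multiset Seg) {x : Seg} {l : List Seg} (hx : x.1 = a)
    (hl : ∀ y ∈ l, a < y.1) :
    (n - ((x :: l : List Seg) : Multiset Seg)).filter (fun Δ => a < Δ.1) =
      n.filter (fun Δ => a < Δ.1) - (l : Multiset Seg) := by
  rw [Multiset.filter_sub, ← Multiset.cons_coe, Multiset.filter_cons_of_neg]
  · rw [(Multiset.filter_eq_self (s := (l : Multiset Seg))).2 (fun y hy => hl y hy)]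
  · omega

theorem usChain_up {a c : ℤ} {e : ℤ} (n : Multiset Seg) (hc : a ≤ c) (k : Multiset Seg)
    (hk : ∀ Δ ∈ k, Δ.1 ≤ c) :
    usChain (n.filter (fun Δ => a < Δ.1) + k) (c, e) = usChain n (c, e) := by
  apply usChain_congr
  rw [Multiset.filter_add, (Multiset.filter_eq_nil (s := k)).2 (fun x hx => by
    have := hk x hx; simp only; omega), add_zero, Multiset.filter_filter]
  apply Multiset.filter_congr
  intro Δ _
  simp only
  constructor
  · intro h; exact h.1
  · intro h; exact ⟨h, by omega⟩

/-- The basic step when the longest segment at `a` is matched. -/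
theorem step_matched {a b e f : ℤ} {n : Multiset Seg} (h : Good a b n)
    (h1 : (a, e) ∈ n) (h2 : ∀ y, (a, y) ∈ n → y ≤ e) (h3 : (a + 1, f) ∈ n)
    (h4 : ∀ y, (a + 1, y) ∈ n → y ≤ f) (hef : e < f) :
    usList n = (a, e) :: (a + 1, f) :: usChain n (a + 1, f) ∧
    unm a (n - (usList n : Multiset Seg)) = unm a n := by
  have hu : usList n = (a, e) :: (a + 1, f) :: usChain n (a + 1, f) := by
    rw [usList_eq h1 (fun Δ hΔ => (h Δ hΔ).1) h2, usChain_some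
      (usNext_adj h (h _ h1).2.2.1 h3 h4 hef)]
  refine ⟨hu, ?_⟩
  rw [hu, sub_cons_cons, unm_sub_other (h.mono ((Multiset.erase_le _ _).trans
    (Multiset.erase_le _ _)))]
  · symm
    exact unm_matched h1 h2 h3 h4 ((prec_iff h (h _ h1).2.2.1 h3).2 ⟨by simp, hef⟩)
  · intro x hx
    have := (usChain_mem _ x hx).2
    simp only at this
    constructor <;> omega

theorem rows_unm_zero {a b : ℤ} (n : Multiset Seg) (h : Good a b n) (hu : unm a n = 0) :
    rowsOf (n.filter (fun Δ => a < Δ.1)) = (rowsOf n).map (dropHead a) ∧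
      ∀ row ∈ rowsOf n, HeadPair a row := by
  induction hk : n.card using Nat.strong_induction_on generalizing n with
  | _ k ih =>
    by_cases hA : ∃ y, (a, y) ∈ n
    · obtain ⟨e, he, hemax⟩ := exists_max_end hA
      by_cases hB : ∃ f, (a + 1, f) ∈ n ∧ e < f
      · obtain ⟨f0, hf0, hef0⟩ := hB
        obtain ⟨f, hf, hfmax⟩ := exists_max_end ⟨f0, hf0⟩
        have hef : e < f := lt_of_lt_of_le hef0 (hfmax _ hf0)
        obtain ⟨hrow, hunm⟩ := step_matched h he hemax hf hfmax hef
        have hn0 : n ≠ 0 := by rintro rfl; simp at he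
        have hcard := usList_sub_card hn0
        have IH := ih _ (by omega) (n - (usList n : Multiset Seg)) (h.mono tsub_le_self)
          (by rw [hunm, hu]) rfl
        have hchain : ∀ y ∈ (a + 1, f) :: usChain n (a + 1, f), a < y.1 := by
          intro y hy
          rcases List.mem_cons.1 hy with rfl | hy
          · simp
          · have := (usChain_mem _ y hy).2; simp only at this; omega
        have hmem' : (a + 1, f) ∈ n.filter (fun Δ => a < Δ.1) := by simp [hf]
        have hrow' : usList (n.filter (fun Δ => a < Δ.1)) =
            (a + 1, f) :: usChain n (a + 1, f) := by
          rw [usList_eq hmem']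
          · have := usChain_up (a := a) (c := a + 1) (e := f) n (by omega) 0 (by simp)
            rw [add_zero] at this
            rw [this]
          · intro Δ hΔ; have := (Multiset.mem_filter.1 hΔ).2; omega
          · intro y hy; exact hfmax y (Multiset.mem_filter.1 hy).1
        have hn0' : n.filter (fun Δ => a < Δ.1) ≠ 0 := by
          intro h0; rw [h0] at hmem'; simp at hmem'
        rw [rowsOf_eq hn0, rowsOf_eq hn0', hrow']
        rw [hrow] at IH ⊢
        rw [filter_sub_row (a := a) n (x := (a, e)) rfl hchain] at IH
        constructor
        · rw [List.map_cons, IH.1]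
          simp [dropHead]
        · intro row hr
          rcases List.mem_cons.1 hr with rfl | hr
          · intro Δ r hh _
            simp only [List.cons.injEq] at hh
            exact ⟨(a + 1, f), _, hh.2.symm, rfl⟩
          · exact IH.2 row hr
      · exfalso
        push Not at hB
        rw [unm_free n he hB] at hu
        simp at hu
    · have hne : ∀ Δ ∈ n, Δ.1 ≠ a := by
        rintro ⟨x, y⟩ hΔ rfl; exact hA ⟨y, hΔ⟩
      have hup : n.filter (fun Δ => a < Δ.1) = n := by
        rw [Multiset.filter_eq_self]
        intro Δ hΔ
        have := (h Δ hΔ).1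
        have := hne Δ hΔ
        omega
      rw [hup]
      constructor
      · symm
        conv_rhs => rw [← List.map_id (rowsOf n)]
        apply List.map_congr_left
        intro row hr
        exact dropHead_of_ne (fun Δ hΔ => hne Δ (rowsOf_mem hr hΔ))
      · intro row hr Δ r hrow hΔ
        exact absurd hΔ (hne Δ (rowsOf_mem hr (by simp [hrow])))

theorem rows_unm_one {a b y : ℤ} (n : Multiset Seg) (h : Good a b n) (hu : unm a n = {(a, y)}) :
    ∃ X r Y, rowsOf n = X ++ ((a, y) :: r) :: Y ∧
      rowsOf (n.filter (fun Δ => a < Δ.1) + {(a + 1, y)}) =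
        X.map (dropHead a) ++ ((a + 1, y) :: r) :: Y.map (dropHead a) ∧
      (∀ row ∈ X, ∃ Δ Δ' r', row = Δ :: Δ' :: r' ∧ Δ.1 = a ∧ Δ'.1 = a + 1) ∧
      (∀ Δ ∈ r, a + 2 ≤ Δ.1) ∧
      (∀ row ∈ Y, HeadPair a row) ∧
      (unm (a + 1) n = 0 → ∀ row ∈ X, HeadPair (a + 1) (dropHead a row)) := by
  induction hk : n.card using Nat.strong_induction_on generalizing n with
  | _ k ih =>
    have hy : (a, y) ∈ n := Multiset.mem_of_le (unm_le a n) (by rw [hu]; simp)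
    have hn0 : n ≠ 0 := by rintro rfl; simp at hy
    have hcard := usList_sub_card hn0
    obtain ⟨e, he, hemax⟩ := exists_max_end ⟨y, hy⟩
    by_cases hB : ∃ f, (a + 1, f) ∈ n ∧ e < f
    · obtain ⟨f0, hf0, hef0⟩ := hB
      obtain ⟨f, hf, hfmax⟩ := exists_max_end ⟨f0, hf0⟩
      have hef : e < f := lt_of_lt_of_le hef0 (hfmax _ hf0)
      obtain ⟨hrow, hunm⟩ := step_matched h he hemax hf hfmax hef
      obtain ⟨X, r, Y, g1, g2, g3, g4, g5, g6⟩ :=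
        ih _ (by omega) (n - (usList n : Multiset Seg)) (h.mono tsub_le_self)
          (by rw [hunm, hu]) rfl
      have hchain : ∀ y ∈ (a + 1, f) :: usChain n (a + 1, f), a < y.1 := by
        intro y hy
        rcases List.mem_cons.1 hy with rfl | hy
        · simp
        · have := (usChain_mem _ y hy).2; simp only at this; omega
      have hmemf : (a + 1, f) ∈ n.filter (fun Δ => a < Δ.1) := by simp [hf]
      have hmem' : (a + 1, f) ∈ n.filter (fun Δ => a < Δ.1) + {(a + 1, y)} :=
        Multiset.mem_add.2 (Or.inl hmemf)
      have hrowup : usList (n.filter (fun Δ => a < Δ.1)) =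
          (a + 1, f) :: usChain n (a + 1, f) := by
        rw [usList_eq hmemf]
        · have := usChain_up (a := a) (c := a + 1) (e := f) n (by omega) 0 (by simp)
          rw [add_zero] at this
          rw [this]
        · intro Δ hΔ; have := (Multiset.mem_filter.1 hΔ).2; omega
        · intro y hy; exact hfmax y (Multiset.mem_filter.1 hy).1
      have hrow' : usList (n.filter (fun Δ => a < Δ.1) + {(a + 1, y)}) =
          (a + 1, f) :: usChain n (a + 1, f) := by
        rw [usList_eq hmem']
        · rw [usChain_up (a := a) (c := a + 1) (e := f) n (by omega) _ (by simp)]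
        · intro Δ hΔ
          rcases Multiset.mem_add.1 hΔ with hΔ | hΔ
          · have := (Multiset.mem_filter.1 hΔ).2; omega
          · rw [Multiset.mem_singleton] at hΔ; subst hΔ; simp
        · intro z hz
          rcases Multiset.mem_add.1 hz with hz | hz
          · exact hfmax z (Multiset.mem_filter.1 hz).1
          · rw [Multiset.mem_singleton] at hz
            simp only [Prod.mk.injEq, true_and] at hz
            have := hemax _ hy
            omega
      have hn0' : n.filter (fun Δ => a < Δ.1) + {(a + 1, y)} ≠ 0 := by
        intro h0; rw [h0] at hmem'; simp at hmem'
      have hsub : n.filter (fun Δ => a < Δ.1) + {(a + 1, y)} -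
          (((a + 1, f) :: usChain n (a + 1, f) : List Seg) : Multiset Seg) =
          (n - (usList n : Multiset Seg)).filter (fun Δ => a < Δ.1) + {(a + 1, y)} := by
        rw [hrow, filter_sub_row (a := a) n (x := (a, e)) rfl hchain]
        symm
        apply tsub_add_eq_add_tsub
        rw [← hrowup]; exact usList_le _
      refine ⟨usList n :: X, r, Y, ?_, ?_, ?_, g4, g5, ?_⟩
      · rw [rowsOf_eq hn0, g1]; rfl
      · rw [rowsOf_eq hn0', hrow', hsub, g2, hrow]; simp [dropHead]
      · intro row hr
        rcases List.mem_cons.1 hr with rfl | hr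
        · exact ⟨_, _, _, hrow, rfl, rfl⟩
        · exact g3 row hr
      · intro hv
        have hC : ∃ g, (a + 1 + 1, g) ∈ n ∧ f < g := by
          by_contra hC
          push Not at hC
          rw [unm_free n hf hC] at hv
          simp at hv
        obtain ⟨w0, hw0, hfw0⟩ := hC
        obtain ⟨w, hw, hwmax⟩ := exists_max_end ⟨w0, hw0⟩
        have hfw : f < w := lt_of_lt_of_le hfw0 (hwmax _ hw0)
        have hnext := usNext_adj h (h _ hf).2.2.1 hw hwmax hfw
        have hch := usChain_some hnext
        have hv' : unm (a + 1) (n - (usList n : Multiset Seg)) = 0 := by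
          rw [hrow, hch, sub_cons_cons, ← Multiset.cons_coe, Multiset.sub_cons]
          rw [unm_sub_other (h.mono ((Multiset.erase_le _ _).trans
            ((Multiset.erase_le _ _).trans (Multiset.erase_le _ _))))]
          · rw [Multiset.erase_comm n, Multiset.erase_comm _ (a, e), ← Multiset.sub_singleton,
              unm_sub_other (h.mono ((Multiset.erase_le _ _).trans (Multiset.erase_le _ _)))]
            · rw [← unm_matched hf hfmax hw hwmax
                ((prec_iff h (h _ hf).2.2.1 hw).2 ⟨by simp, hfw⟩), hv]
            · intro x hx
              rw [Multiset.mem_singleton] at hx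
              subst hx
              simp only
              constructor <;> omega
          · intro x hx
            have := (usChain_mem _ x hx).2
            simp only at this
            constructor <;> omega
        intro row hr
        rcases List.mem_cons.1 hr with rfl | hr
        · rw [hrow, hch]
          intro Δ r hh _
          simp only [dropHead, if_true, List.cons.injEq] at hh
          exact ⟨_, _, hh.2.symm, rfl⟩
        · exact g6 hv' row hr
    · push Not at hB
      rw [unm_free n he hB] at hu
      obtain rfl : e = y := by
        have h1 : (a, e) ∈ ({(a, y)} : Multiset Seg) := by
          rw [← hu]; exact Multiset.mem_cons_self _ _
        simpa using h1
      have hu0 := (Multiset.cons_inj_right (a, e)).1 (hu.trans (Multiset.cons_zero (a, e)).symm)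
      have hrow : usList n = (a, e) :: usChain n (a, e) :=
        usList_eq he (fun Δ hΔ => (h Δ hΔ).1) hemax
      have hr2 : ∀ Δ ∈ usChain n (a, e), a + 2 ≤ Δ.1 := by
        cases hnx : usNext n (a, e) with
        | none => rw [usChain_none hnx]; simp
        | some q =>
          rw [usChain_some hnx]
          have hq := usNext_eq_some.1 hnx
          have hq2 : a + 2 ≤ q.1 := by
            have h1 : a < q.1 := hq.2.1.1
            have h2 : e < q.2 := hq.2.1.2.1
            by_contra hlt
            have h3 : q.1 = a + 1 := by omega
            have := hB q.2 (by rw [← h3]; exact hq.1)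
            omega
          intro Δ hΔ
          rcases List.mem_cons.1 hΔ with rfl | hΔ
          · exact hq2
          · have := (usChain_mem _ Δ hΔ).2; omega
      have hunm : unm a (n - (usList n : Multiset Seg)) = 0 := by
        rw [hrow, ← Multiset.cons_coe, Multiset.sub_cons,
          unm_sub_other (h.mono (Multiset.erase_le _ _)), hu0]
        intro x hx
        have := hr2 x hx
        constructor <;> omega
      have IH := rows_unm_zero _ (h.mono tsub_le_self) hunm
      have hmem' : (a + 1, e) ∈ n.filter (fun Δ => a < Δ.1) + {(a + 1, e)} := by simp
      have hn0' : n.filter (fun Δ => a < Δ.1) + {(a + 1, e)} ≠ 0 := by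
        intro h0; rw [h0] at hmem'; simp at hmem'
      have hnexts : usNext (n.filter (fun Δ => a < Δ.1) + {(a + 1, e)}) (a + 1, e) =
          usNext n (a, e) := by
        have hbe := (h _ he).2.2.1
        have hP : ∀ q, q ∈ n.filter (fun Δ => a < Δ.1) + {(a + 1, e)} ∧ Prec (a + 1, e) q ↔
            q ∈ n ∧ Prec (a, e) q := by
          intro q
          constructor
          · rintro ⟨hq1, hq2⟩
            rcases Multiset.mem_add.1 hq1 with hq1 | hq1
            · have hqn := (Multiset.mem_filter.1 hq1).1
              refine ⟨hqn, ?_⟩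
              rw [prec_iff h (p := (a + 1, e)) hbe hqn] at hq2
              rw [prec_iff h hbe hqn]
              simp only at hq2 ⊢
              omega
            · rw [Multiset.mem_singleton] at hq1
              subst hq1
              exact absurd hq2.1 (lt_irrefl _)
          · rintro ⟨hq1, hq2⟩
            have hq2' := hq2
            rw [prec_iff h hbe hq1] at hq2
            simp only at hq2
            have hne : q.1 ≠ a + 1 := by
              intro h3
              have := hB q.2 (by rw [← h3]; exact hq1)
              omega
            refine ⟨Multiset.mem_add.2 (Or.inl (Multiset.mem_filter.2 ⟨hq1, hq2.1⟩)), ?_⟩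
            rw [prec_iff h (p := (a + 1, e)) hbe hq1]
            simp only
            omega
        cases hnx : usNext n (a, e) with
        | none =>
          rw [usNext_eq_none] at hnx ⊢
          intro q hq hp
          have := (hP q).1 ⟨hq, hp⟩
          exact hnx q this.1 this.2
        | some q =>
          rw [usNext_eq_some] at hnx ⊢
          obtain ⟨k1, k2, k3⟩ := hnx
          have := (hP q).2 ⟨k1, k2⟩
          refine ⟨this.1, this.2, fun s hs hp => ?_⟩
          have := (hP s).1 ⟨hs, hp⟩
          exact k3 s this.1 this.2
      have hch : usChain (n.filter (fun Δ => a < Δ.1) + {(a + 1, e)}) (a + 1, e) =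
          usChain n (a, e) := by
        cases hnx : usNext n (a, e) with
        | none => rw [usChain_none hnx, usChain_none (by rw [hnexts, hnx])]
        | some q =>
          rw [usChain_some hnx, usChain_some (by rw [hnexts, hnx])]
          obtain ⟨u, v⟩ := q
          have hu2 := hr2 (u, v) (by rw [usChain_some hnx]; simp)
          simp only at hu2
          rw [usChain_up n (by omega)]
          intro Δ hΔ
          rw [Multiset.mem_singleton] at hΔ; subst hΔ
          simp only; omega
      have hrow' : usList (n.filter (fun Δ => a < Δ.1) + {(a + 1, e)}) =
          (a + 1, e) :: usChain n (a, e) := by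
        rw [usList_eq hmem', hch]
        · intro Δ hΔ
          rcases Multiset.mem_add.1 hΔ with hΔ | hΔ
          · have := (Multiset.mem_filter.1 hΔ).2; omega
          · rw [Multiset.mem_singleton] at hΔ; subst hΔ; simp
        · intro z hz
          rcases Multiset.mem_add.1 hz with hz | hz
          · exact hB z (Multiset.mem_filter.1 hz).1
          · rw [Multiset.mem_singleton] at hz
            simp only [Prod.mk.injEq, true_and] at hz
            omega
      refine ⟨[], usChain n (a, e), rowsOf (n - (usList n : Multiset Seg)), ?_, ?_, by simp, hr2,
        IH.2, by simp⟩
      · rw [rowsOf_eq hn0, hrow]; rfl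
      · rw [rowsOf_eq hn0', hrow', ← IH.1, hrow,
          filter_sub_row (a := a) n (x := (a, e)) rfl (fun y hy => by have := hr2 y hy; omega)]
        simp only [List.map_nil, List.nil_append]
        rw [← Multiset.cons_coe, Multiset.sub_cons, Multiset.erase_add_right_pos _ (by simp)]
        simp

/-! ### The selection process -/

theorem rowsOf_tail {n : Multiset Seg} {row : List Seg} (hr : row ∈ rowsOf n) :
    ∀ Δ r, row = Δ :: r → ∀ x ∈ r, Δ.1 < x.1 := by
  induction hk : n.card using Nat.strong_induction_on generalizing n with
  | _ k ih =>
    by_cases h : n = 0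
    · subst h; rw [rowsOf_zero] at hr; simp at hr
    · have hc := usList_sub_card h
      rw [rowsOf_eq h] at hr
      rcases List.mem_cons.1 hr with rfl | hr
      · obtain ⟨c, e, h1, h2, h3⟩ := exists_first h
        rw [usList_eq h1 h2 h3]
        intro Δ r hh x hx
        simp only [List.cons.injEq] at hh
        obtain ⟨rfl, rfl⟩ := hh
        exact (usChain_mem _ x hx).2
      · exact ih _ (by omega) hr rfl

theorem dropHead_gt {c : ℤ} {n : Multiset Seg} (hn : ∀ Δ ∈ n, c ≤ Δ.1) {row : List Seg}
    (hr : row ∈ rowsOf n) : ∀ Δ ∈ dropHead c row, c < Δ.1 := by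
  have ht := rowsOf_tail hr
  cases row with
  | nil => simp [dropHead]
  | cons x r =>
    have hx := hn x (rowsOf_mem hr (by simp))
    have hr' := ht x r rfl
    intro Δ hΔ
    simp only [dropHead] at hΔ
    split_ifs at hΔ with hxc
    · have := hr' Δ hΔ; omega
    · rcases List.mem_cons.1 hΔ with rfl | hΔ
      · omega
      · have := hr' Δ hΔ; omega

theorem findRowD_mem : ∀ (row : List Seg) (t : ℤ) (Δ : Seg), findRowD row t = some Δ → Δ ∈ row
  | [], _, _, h => by simp [findRowD] at h
  | [x], t, Δ, h => by
    unfold findRowD at h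
    split_ifs at h
    simp_all
  | x :: y :: r, t, Δ, h => by
    unfold findRowD at h
    split_ifs at h
    · simp_all
    · exact List.mem_cons_of_mem _ (findRowD_mem (y :: r) t Δ h)

/-- One step of the selection. -/
def stepSel (row : List Seg) (t : ℤ) : List (Seg × ℤ) :=
  match findRowD row t with
  | some Δ => [(Δ, t + 1)]
  | none => []

/-- The top after one step of the selection. -/
def stepTop (row : List Seg) (t : ℤ) : ℤ :=
  match findRowD row t with
  | some Δ => Δ.1 - 1
  | none => t

/-- The top after scanning all rows, from the last to the first. -/
def topL : List (List Seg) → ℤ → ℤ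
  | [], t => t
  | row :: rows, t => stepTop row (topL rows t)

/-- The selection obtained by scanning all rows, from the last to the first. -/
def selL : List (List Seg) → ℤ → List (Seg × ℤ)
  | [], _ => []
  | row :: rows, t => selL rows t ++ stepSel row (topL rows t)

theorem topL_append (X Y : List (List Seg)) (t : ℤ) : topL (X ++ Y) t = topL X (topL Y t) := by
  induction X with
  | nil => rfl
  | cons x X ih => simp [topL, ih]

theorem selL_append (X Y : List (List Seg)) (t : ℤ) :
    selL (X ++ Y) t = selL Y t ++ selL X (topL Y t) := by
  induction X with
  | nil => simp [selL]
  | cons x X ih => simp [selL, ih, topL_append]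

theorem selAuxD_eq (rows : List (List Seg)) : ∀ (k : ℕ), k ≤ rows.length → ∀ t : ℤ,
    selAuxD rows k t = selL (rows.take k) t := by
  intro k
  induction k with
  | zero => intro _ t; simp [selAuxD, selL]
  | succ k ih =>
    intro hk t
    have hk' : k < rows.length := by omega
    have h1 : rows.take (k + 1) = rows.take k ++ [rows[k]] := by simp
    have h2 : rows.getD k [] = rows[k] := by
      simp [List.getD, hk']
    rw [h1, selL_append]
    unfold selAuxD
    rw [h2]
    simp only [topL, selL, stepSel, stepTop, List.nil_append]
    cases hf : findRowD rows[k] t with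
    | none => simp [ih (by omega)]
    | some Δ => simp [ih (by omega)]

theorem sel_last (rows : List (List Seg)) (t : ℤ) :
    (selL rows t = [] → topL rows t = t) ∧
    ∀ p, (selL rows t).getLast? = some p → topL rows t = p.1.1 - 1 := by
  induction rows with
  | nil => simp [selL, topL]
  | cons row rows ih =>
    simp only [selL, topL, stepSel, stepTop]
    cases hf : findRowD row (topL rows t) with
    | none => simpa using ih
    | some Δ =>
      simp only [List.append_eq_nil_iff, List.getLast?_append]
      constructor
      · intro h; simp at h
      · intro p hp
        simp at hp
        subst hp
        rfl

/-- The replacement step. -/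
def repl (acc : Multiset Seg) (p : Seg × ℤ) : Multiset Seg := pushSeg (acc.erase p.1) p.2 p.1.2

theorem DLang_eq {a b : ℤ} (m : Multiset Seg) (h : b ≠ a - 1) :
    DLang a b m = if topL (rowsOf (mRange m a b)) b = a - 1 then
      some ((selL (rowsOf (mRange m a b)) b).foldl repl m) else none := by
  have hs : selAuxD (rowsOf (mRange m a b)) (rowsOf (mRange m a b)).length b =
      selL (rowsOf (mRange m a b)) b := by
    rw [selAuxD_eq _ _ le_rfl, List.take_length]
  have hl := sel_last (rowsOf (mRange m a b)) b
  unfold DLang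
  simp only
  change (match (selAuxD (rowsOf (mRange m a b)) (rowsOf (mRange m a b)).length b).getLast? with
    | none => none
    | some (Δl, _) => if Δl.1 = a then some ((selAuxD (rowsOf (mRange m a b))
        (rowsOf (mRange m a b)).length b).foldl repl m) else none) = _
  rw [hs]
  cases hg : (selL (rowsOf (mRange m a b)) b).getLast? with
  | none =>
    rw [List.getLast?_eq_none_iff] at hg
    have := hl.1 hg
    simp only
    rw [if_neg (by omega)]
  | some p =>
    have := hl.2 p hg
    obtain ⟨Δ, x⟩ := p
    simp only at this ⊢
    rw [this]
    by_cases hΔ : Δ.1 = a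
    · rw [if_pos hΔ, if_pos (by omega)]
    · rw [if_neg hΔ, if_neg (by omega)]

/-- The total multisegment added in the replacement. -/
def addW (l : List (Seg × ℤ)) : Multiset Seg := (l.map fun p => pushSeg 0 p.2 p.1.2).sum

theorem addW_append (l l' : List (Seg × ℤ)) : addW (l ++ l') = addW l + addW l' := by
  simp [addW]

theorem pushSeg_eq (m : Multiset Seg) (x y : ℤ) : pushSeg m x y = m + pushSeg 0 x y := by
  unfold pushSeg; split_ifs <;> simp

theorem foldl_repl (l : List (Seg × ℤ)) : ∀ acc : Multiset Seg,
    ((l.map Prod.fst : List Seg) : Multiset Seg) ≤ acc →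
    l.foldl repl acc + ((l.map Prod.fst : List Seg) : Multiset Seg) = acc + addW l := by
  induction l with
  | nil => intro acc _; simp [addW]
  | cons p l ih =>
    intro acc h
    rw [List.map_cons, ← Multiset.cons_coe] at h
    obtain ⟨k, rfl⟩ := Multiset.le_iff_exists_add.1 h
    have e : repl (p.1 ::ₘ ((l.map Prod.fst : List Seg) : Multiset Seg) + k) p =
        ((l.map Prod.fst : List Seg) : Multiset Seg) + k + pushSeg 0 p.2 p.1.2 := by
      unfold repl
      rw [pushSeg_eq, Multiset.cons_add, Multiset.erase_cons_head]
    have := ih (((l.map Prod.fst : List Seg) : Multiset Seg) + k + pushSeg 0 p.2 p.1.2)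
      (by rw [add_assoc]; exact Multiset.le_add_right _ _)
    rw [List.foldl_cons, e, List.map_cons, ← Multiset.cons_coe, ← Multiset.singleton_add,
      add_left_comm, this]
    have hW : addW (p :: l) = pushSeg 0 p.2 p.1.2 + addW l := by simp [addW]
    rw [hW]
    abel

theorem addW_noop (l : List (Seg × ℤ)) (h : ∀ p ∈ l, p.2 = p.1.1 ∧ p.1.1 ≤ p.1.2) :
    addW l = ((l.map Prod.fst : List Seg) : Multiset Seg) := by
  induction l with
  | nil => simp [addW]
  | cons p l ih =>
    have hW : addW (p :: l) = pushSeg 0 p.2 p.1.2 + addW l := by simp [addW]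
    have hp := h p (by simp)
    rw [hW, ih (fun q hq => h q (by simp [hq])), hp.1, pushSeg, if_pos hp.2, List.map_cons,
      ← Multiset.cons_coe, ← Multiset.singleton_add, zero_add]

theorem stepSel_le (row : List Seg) (t : ℤ) :
    (((stepSel row t).map Prod.fst : List Seg) : Multiset Seg) ≤ (row : Multiset Seg) := by
  unfold stepSel
  cases hf : findRowD row t with
  | none => simp
  | some Δ =>
    have := findRowD_mem _ _ _ hf
    simpa using this

theorem selL_le (rows : List (List Seg)) (t : ℤ) :
    (((selL rows t).map Prod.fst : List Seg) : Multiset Seg) ≤ (rows.flatten : Multiset Seg) := by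
  induction rows with
  | nil => simp [selL]
  | cons row rows ih =>
    simp only [selL, List.map_append, List.flatten_cons]
    rw [← Multiset.coe_add, ← Multiset.coe_add, add_comm]
    exact add_le_add (stepSel_le _ _) ih

theorem findRowD_void {t : ℤ} {Δ : Seg} {r : List Seg} (h : t < Δ.1) :
    findRowD (Δ :: r) t = some Δ := by
  cases r <;> simp [findRowD, intSubB, h]

/-- Rows with heads at `c`, and top `c - 1`, only produce trivial replacements. -/
theorem noop_rows {c : ℤ} (X : List (List Seg))
    (h : ∀ row ∈ X, ∃ Δ r, row = Δ :: r ∧ Δ.1 = c) :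
    topL X (c - 1) = c - 1 ∧ ∀ p ∈ selL X (c - 1), p.2 = p.1.1 := by
  induction X with
  | nil => simp [topL, selL]
  | cons row X ih =>
    obtain ⟨h1, h2⟩ := ih (fun r hr => h r (by simp [hr]))
    obtain ⟨Δ, r, rfl, hΔ⟩ := h row (by simp)
    have hf : findRowD (Δ :: r) (c - 1) = some Δ := findRowD_void (by omega)
    simp only [topL, selL, h1, stepTop, stepSel, hf]
    refine ⟨by omega, ?_⟩
    intro p hp
    rcases List.mem_append.1 hp with hp | hp
    · exact h2 p hp
    · simp only [List.mem_singleton] at hp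
      subst hp
      simp only; omega

theorem findRowD_dropHead {c t : ℤ} {row : List Seg} (h : HeadPair c row) (ht : c ≤ t) :
    findRowD (dropHead c row) t = findRowD row t := by
  cases row with
  | nil => rfl
  | cons Δ r =>
    simp only [dropHead]
    split_ifs with hΔ
    · obtain ⟨Δ', r', rfl, hΔ'⟩ := h Δ r rfl hΔ
      conv_rhs => unfold findRowD
      rw [if_neg]
      simp only [intSubB, Bool.or_eq_true, Bool.and_eq_true, decide_eq_true_eq]
      omega
    · rfl

theorem rows_pair {c : ℤ} (X : List (List Seg)) (h : ∀ row ∈ X, HeadPair c row)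
    (h' : ∀ row ∈ X, ∀ Δ ∈ dropHead c row, c < Δ.1) {t : ℤ} (ht : c ≤ t) :
    c ≤ topL X t ∧ topL (X.map (dropHead c)) t = topL X t ∧
      selL (X.map (dropHead c)) t = selL X t := by
  induction X with
  | nil => simp [topL, selL, ht]
  | cons row X ih =>
    obtain ⟨h1, h2, h3⟩ := ih (fun r hr => h r (by simp [hr])) (fun r hr => h' r (by simp [hr]))
    have hf := findRowD_dropHead (h row (by simp)) h1
    simp only [List.map_cons, topL, selL, h2, h3, stepTop, stepSel, hf]
    refine ⟨?_, trivial, trivial⟩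
    cases hg : findRowD row (topL X t) with
    | none => exact h1
    | some Δ =>
      rw [hg] at hf
      have := h' row (by simp) Δ (findRowD_mem _ _ _ hf)
      simp only; omega

theorem row_free {a y T : ℤ} {r : List Seg} (hT : a ≤ T) (hy : a ≤ y)
    (hr : ∀ Δ ∈ r, a + 2 ≤ Δ.1) :
    (findRowD ((a, y) :: r) T = some (a, y) ∧ findRowD ((a + 1, y) :: r) T = some (a + 1, y)) ∨
    (a + 1 ≤ T ∧ findRowD ((a, y) :: r) T = findRowD ((a + 1, y) :: r) T ∧
      ∀ Δ, findRowD ((a, y) :: r) T = some Δ → a + 2 ≤ Δ.1) := by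
  cases r with
  | nil =>
    simp only [findRowD, intSubB]
    by_cases h : T ≤ y
    · left; simp [h]
    · right
      have h1 : ¬ T < a := by omega
      have h2 : ¬ T < a + 1 := by omega
      refine ⟨by omega, by simp [h, h1, h2], by simp [h, h1]⟩
  | cons q r =>
    have hq := hr q (by simp)
    by_cases h : T ≤ q.1 - 2
    · left; simp [findRowD, intSubB, h]
    · right
      have h1 : ¬ T < a := by omega
      have h2 : ¬ T < a + 1 := by omega
      have e1 : findRowD ((a, y) :: q :: r) T = findRowD (q :: r) T := by
        simp [findRowD, intSubB, h, h1]
      have e2 : findRowD ((a + 1, y) :: q :: r) T = findRowD (q :: r) T := by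
        simp [findRowD, intSubB, h, h2]
      refine ⟨by omega, by rw [e1, e2], fun Δ hΔ => ?_⟩
      rw [e1] at hΔ
      exact hr Δ (findRowD_mem _ _ _ hΔ)

theorem mRange_le (m : Multiset Seg) (a b : ℤ) : mRange m a b ≤ m := Multiset.filter_le _ _

theorem good_mRange {m : Multiset Seg} (hm : IsMS m) (a b : ℤ) : Good a b (mRange m a b) := by
  intro Δ hΔ
  obtain ⟨h1, h2, h3, h4⟩ := Multiset.mem_filter.1 hΔ
  exact ⟨h2, h3, h4, hm Δ h1⟩

theorem sel_le_m (m : Multiset Seg) (a b t : ℤ) :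
    (((selL (rowsOf (mRange m a b)) t).map Prod.fst : List Seg) : Multiset Seg) ≤ m :=
  (selL_le _ _).trans ((rowsOf_flatten_le _).trans (mRange_le m a b))

theorem core_one {m m' : Multiset Seg} (hm : IsMS m) (hm' : IsMS m') {a b y : ℤ} (hab : a < b)
    (hmm : m' + {(a, y)} = m + {(a + 1, y)})
    (hu : unm a (mRange m a b) = {(a, y)})
    (hr' : mRange m' (a + 1) b = (mRange m a b).filter (fun Δ => a < Δ.1) + {(a + 1, y)}) :
    (DLang a b m ≠ none → DLang (a + 1) b m' = DLang a b m) ∧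
    (unm (a + 1) (mRange m a b) = 0 → DLang (a + 1) b m' ≠ none →
      DLang a b m = DLang (a + 1) b m') := by
  have hG := good_mRange hm a b
  have hG' := good_mRange hm' (a + 1) b
  obtain ⟨X, r, Y, g1, g2, g3, g4, g5, g6⟩ := rows_unm_one _ hG hu
  rw [← hr'] at g2
  have hyn : (a, y) ∈ mRange m a b := Multiset.mem_of_le (unm_le _ _) (by rw [hu]; simp)
  have hby : b ≤ y := (hG _ hyn).2.2.1
  have dg : ∀ row ∈ rowsOf (mRange m a b), ∀ Δ ∈ dropHead a row, a < Δ.1 := fun row hr =>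
    dropHead_gt (fun Δ hΔ => (hG Δ hΔ).1) hr
  have dg' : ∀ row ∈ rowsOf (mRange m' (a + 1) b), ∀ Δ ∈ dropHead (a + 1) row, a + 1 < Δ.1 :=
    fun row hr => dropHead_gt (fun Δ hΔ => (hG' Δ hΔ).1) hr
  obtain ⟨y1, y2, y3⟩ := rows_pair Y g5 (fun row hr => dg row (by rw [g1]; simp [hr])) hab.le
  have sm := sel_le_m m a b b
  have sm' := sel_le_m m' (a + 1) b b
  have fm := foldl_repl _ m sm
  have fm' := foldl_repl _ m' sm'
  have hval : ∀ p ∈ selL (rowsOf (mRange m a b)) b, p.1.1 ≤ p.1.2 := fun p hp =>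
    hm _ (Multiset.mem_of_le sm (Multiset.mem_coe.2 (List.mem_map_of_mem hp)))
  have hval' : ∀ p ∈ selL (rowsOf (mRange m' (a + 1) b)) b, p.1.1 ≤ p.1.2 := fun p hp =>
    hm' _ (Multiset.mem_of_le sm' (Multiset.mem_coe.2 (List.mem_map_of_mem hp)))
  rw [DLang_eq m (by omega), DLang_eq m' (by omega)]
  have s1 : selL (rowsOf (mRange m a b)) b = selL Y b ++ stepSel ((a, y) :: r) (topL Y b) ++
      selL X (stepTop ((a, y) :: r) (topL Y b)) := by
    rw [g1, selL_append]; rfl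
  have t1 : topL (rowsOf (mRange m a b)) b = topL X (stepTop ((a, y) :: r) (topL Y b)) := by
    rw [g1, topL_append]; rfl
  have s2 : selL (rowsOf (mRange m' (a + 1) b)) b =
      selL Y b ++ stepSel ((a + 1, y) :: r) (topL Y b) ++
      selL (X.map (dropHead a)) (stepTop ((a + 1, y) :: r) (topL Y b)) := by
    rw [g2, selL_append]; simp only [selL, topL, y2, y3]
  have t2 : topL (rowsOf (mRange m' (a + 1) b)) b =
      topL (X.map (dropHead a)) (stepTop ((a + 1, y) :: r) (topL Y b)) := by
    rw [g2, topL_append]; simp only [topL, y2]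
  rcases row_free (y := y) y1 (by omega) g4 with ⟨f1, f2⟩ | ⟨hT, f1, f2⟩
  · have n1 := noop_rows (c := a) X (fun row hr => by
      obtain ⟨Δ, Δ', r', e, h1, h2⟩ := g3 row hr; exact ⟨_, _, e, h1⟩)
    have n2 := noop_rows (c := a + 1) (X.map (dropHead a)) (fun row hr => by
      obtain ⟨row0, hr0, rfl⟩ := List.mem_map.1 hr
      obtain ⟨Δ, Δ', r', e, h1, h2⟩ := g3 row0 hr0
      exact ⟨Δ', r', by rw [e]; simp [dropHead, h1], h2⟩)
    simp only [stepSel, stepTop, f1] at s1 t1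
    simp only [stepSel, stepTop, f2] at s2 t2
    rw [n1.1] at t1
    rw [n2.1] at t2
    rw [if_pos t1, if_pos t2]
    have key : (selL (rowsOf (mRange m' (a + 1) b)) b).foldl repl m' =
        (selL (rowsOf (mRange m a b)) b).foldl repl m := by
      have w1 := addW_noop (selL X (a - 1)) (fun p hp => ⟨n1.2 p hp, hval p (by rw [s1]; simp [hp])⟩)
      have w2 := addW_noop (selL (X.map (dropHead a)) (a + 1 - 1))
        (fun p hp => ⟨n2.2 p hp, hval' p (by rw [s2]; simp only [List.mem_append]; exact Or.inr hp)⟩)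
      generalize (selL (rowsOf (mRange m' (a + 1) b)) b).foldl repl m' = F' at fm' ⊢
      generalize (selL (rowsOf (mRange m a b)) b).foldl repl m = F at fm ⊢
      rw [s1] at fm
      rw [s2] at fm'
      simp only [List.map_append, ← Multiset.coe_add, addW_append] at fm fm'
      rw [w1] at fm
      rw [w2] at fm'
      have wy : addW [((a, y), topL Y b + 1)] = addW [((a + 1, y), topL Y b + 1)] := by
        simp [addW]
      rw [wy] at fm
      simp only [List.map_cons, List.map_nil, Multiset.coe_singleton] at fm fm'
      rw [← add_assoc, ← add_assoc, ← add_assoc, ← add_assoc, add_left_inj] at fm fm'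
      generalize addW [((a + 1, y), topL Y b + 1)] = w at fm fm'
      generalize addW (selL Y b) = W at fm fm'
      generalize (((selL Y b).map Prod.fst : List Seg) : Multiset Seg) = S at fm fm'
      have q : F' + (S + {(a, y)} + {(a + 1, y)}) = F + (S + {(a, y)} + {(a + 1, y)}) := by
        calc F' + (S + {(a, y)} + {(a + 1, y)}) = (F' + S + {(a + 1, y)}) + {(a, y)} := by abel
          _ = (m' + {(a, y)}) + W + w := by rw [fm']; abel
          _ = (m + W + w) + {(a + 1, y)} := by rw [hmm]; abel
          _ = F + (S + {(a, y)} + {(a + 1, y)}) := by rw [← fm]; abel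
      exact add_right_cancel q
    rw [key]
    exact ⟨fun _ => rfl, fun _ _ => rfl⟩
  · have hst : stepTop ((a + 1, y) :: r) (topL Y b) = stepTop ((a, y) :: r) (topL Y b) := by
      simp only [stepTop, f1]
    have hge : a + 1 ≤ stepTop ((a, y) :: r) (topL Y b) := by
      unfold stepTop
      cases hf : findRowD ((a, y) :: r) (topL Y b) with
      | none => exact hT
      | some Δ => have := f2 Δ hf; simp only; omega
    rw [hst] at t2
    have k1 := (rows_pair (c := a) X (fun row hr => by
      obtain ⟨Δ, Δ', r', e, h1, h2⟩ := g3 row hr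
      intro x l hx _
      rw [e] at hx
      simp only [List.cons.injEq] at hx
      exact ⟨Δ', r', hx.2.symm, h2⟩) (fun row hr => dg row (by rw [g1]; simp [hr]))
      (t := stepTop ((a, y) :: r) (topL Y b)) (by omega)).1
    rw [if_neg (by omega)]
    refine ⟨fun h => absurd rfl h, fun hz hne => ?_⟩
    exfalso
    have k2 := (rows_pair (c := a + 1) (X.map (dropHead a)) (fun row hr => by
      obtain ⟨row0, hr0, rfl⟩ := List.mem_map.1 hr
      exact g6 hz row0 hr0) (fun row hr => dg' row (by
        rw [g2]; exact List.mem_append.2 (Or.inl hr))) hge).1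
    rw [if_neg (by omega)] at hne
    exact hne rfl

/-- If `ε` vanishes then the Langlands derivative is infinite. -/
theorem DLang_none {m : Multiset Seg} (hm : IsMS m) {a b : ℤ} (hab : a ≤ b)
    (hu : unm a (mRange m a b) = 0) : DLang a b m = none := by
  have hG := good_mRange hm a b
  have h := (rows_pair _ (rows_unm_zero _ hG hu).2 (fun row hr =>
    dropHead_gt (fun Δ hΔ => (hG Δ hΔ).1) hr) hab).1
  rw [DLang_eq m (by omega), if_neg (by omega)]

theorem unm_mRange (m : Multiset Seg) {a b c : ℤ} (h1 : a ≤ c) (h2 : c ≤ b) :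
    unm c (mRange m a b) = (unm c m).filter fun Δ => b ≤ Δ.2 := by
  rw [← unm_filter (fun x => a ≤ x ∧ x ≤ b + 1) (by omega) (by omega)]
  congr 1
  unfold mRange
  apply Multiset.filter_congr
  intro Δ _
  rw [and_assoc]

theorem stmt1_core (m : Multiset Seg) (hm : IsMS m) (a b : ℤ) (hab : a < b)
    (heps : epsA a m = 1) :
    (DLang a b m ≠ none → (Drho a m).bind (DLang (a + 1) b) = DLang a b m) ∧
    (epsA (a + 1) m = 0 → (Drho a m).bind (DLang (a + 1) b) ≠ none →
      DLang a b m = (Drho a m).bind (DLang (a + 1) b)) := by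
  obtain ⟨y, hu⟩ : ∃ y, unm a m = {(a, y)} := by
    obtain ⟨Δ, hΔ⟩ := Multiset.card_eq_one.1 heps
    have h1 : Δ ∈ startAt (tdsIter a m) a := by rw [hΔ]; simp
    have h2 := (Multiset.mem_filter.1 h1).2
    refine ⟨Δ.2, ?_⟩
    rw [← h2]; rw [← h2] at hΔ; exact hΔ
  have hym : (a, y) ∈ m := Multiset.mem_of_le (unm_le _ _) (by rw [hu]; simp)
  have hD : Drho a m = some (pushSeg (m.erase (a, y)) (a + 1) y) := by
    have hs : shortStart (tdsIter a m) a = some (a, y) := by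
      have hu' : startAt (tdsIter a m) a = {(a, y)} := hu
      have : msetMin (({(a, y)} : Multiset Seg).map Prod.snd) = some y := by
        rw [msetMin_eq_some]; simp
      unfold shortStart
      rw [hu', this]; rfl
    unfold Drho
    rw [hs]; rfl
  rw [hD]
  simp only [Option.bind_some]
  have hue : epsA (a + 1) m = 0 → unm (a + 1) m = 0 := fun h => Multiset.card_eq_zero.1 h
  obtain ⟨k, hk⟩ := Multiset.exists_cons_of_mem hym
  have hke : m.erase (a, y) = k := by rw [hk, Multiset.erase_cons_head]
  by_cases hyb : b ≤ y
  · have hpush : pushSeg (m.erase (a, y)) (a + 1) y = k + {(a + 1, y)} := by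
      rw [hke, pushSeg, if_pos (by omega)]
    rw [hpush]
    have hm' : IsMS (k + {(a + 1, y)}) := by
      intro Δ hΔ
      rcases Multiset.mem_add.1 hΔ with hΔ | hΔ
      · exact hm Δ (by rw [hk]; exact Multiset.mem_cons_of_mem hΔ)
      · rw [Multiset.mem_singleton] at hΔ; subst hΔ; simp only; omega
    have := core_one (y := y) hm hm' hab (by rw [hk, ← Multiset.singleton_add]; abel)
      (by rw [unm_mRange m le_rfl hab.le, hu, Multiset.filter_singleton, if_pos hyb])
      (by
        have e : ({(a + 1, y)} : Multiset Seg).filter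
            (fun Δ => a + 1 ≤ Δ.1 ∧ Δ.1 ≤ b + 1 ∧ b ≤ Δ.2) = {(a + 1, y)} := by
          rw [Multiset.filter_singleton, if_pos]
          simp only; omega
        unfold mRange
        rw [hk, Multiset.filter_add, Multiset.filter_filter, Multiset.filter_cons_of_neg _ (by simp),
          e]
        congr 1
        apply Multiset.filter_congr
        intro Δ _
        omega)
    exact ⟨this.1, fun h h' => this.2 (by
      rw [unm_mRange m (by omega) (by omega), hue h]; rfl) h'⟩
  · have h0 : DLang a b m = none := DLang_none hm hab.le (by
      rw [unm_mRange m le_rfl hab.le, hu, Multiset.filter_singleton, if_neg hyb]; rfl)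
    rw [h0]
    refine ⟨fun h => absurd rfl h, fun h h' => ?_⟩
    exfalso
    apply h'
    have hm' : IsMS (pushSeg (m.erase (a, y)) (a + 1) y) := by
      intro Δ hΔ
      unfold pushSeg at hΔ
      split_ifs at hΔ with hc
      · rcases Multiset.mem_add.1 hΔ with hΔ | hΔ
        · exact hm Δ (Multiset.mem_of_mem_erase hΔ)
        · rw [Multiset.mem_singleton] at hΔ; subst hΔ; exact hc
      · exact hm Δ (Multiset.mem_of_mem_erase hΔ)
    apply DLang_none hm' (by omega)
    have e : mRange (pushSeg (m.erase (a, y)) (a + 1) y) (a + 1) b = mRange m (a + 1) b := by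
      have e1 : mRange (m.erase (a, y)) (a + 1) b = mRange m (a + 1) b := by
        unfold mRange
        rw [hke, hk, Multiset.filter_cons_of_neg _ (by simp)]
      rw [pushSeg_eq, ← e1]
      unfold mRange
      rw [Multiset.filter_add, (Multiset.filter_eq_nil (s := pushSeg 0 (a + 1) y)).2, add_zero]
      intro Δ hΔ
      unfold pushSeg at hΔ
      split_ifs at hΔ
      · simp only [zero_add, Multiset.mem_singleton] at hΔ
        subst hΔ; simp only; omega
      · simp at hΔ
    rw [e, unm_mRange m le_rfl (by omega), hue h]; rfl

/-- if `ε_{[a]}(m) = 1` then (i) whenever `𝒟^Lang_{[a,b]}(m) ≠ ∞`,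
`𝒟^Lang_{[a+1,b]}(𝒟_{[a]}(m)) = 𝒟^Lang_{[a,b]}(m)`; and (ii) if moreover
`ε_{[a+1]}(m) = 0` and `𝒟^Lang_{[a+1,b]}(𝒟_{[a]}(m)) ≠ ∞`, then
`𝒟^Lang_{[a,b]}(m) = 𝒟^Lang_{[a+1,b]}(𝒟_{[a]}(m))`. -/
theorem stmt1 (m : Multiset Seg) (hm : IsMS m) (a b : ℤ) (hab : a < b)
    (heps : epsA a m = 1) :
    (DLang a b m ≠ none → (Drho a m).bind (DLang (a + 1) b) = DLang a b m) ∧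
    (epsA (a + 1) m = 0 → (Drho a m).bind (DLang (a + 1) b) ≠ none →
      DLang a b m = (Drho a m).bind (DLang (a + 1) b)) := by
  exact stmt1_core m hm a b hab heps

end Multiseg
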